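/- arXiv:2005.06222 — 11 statements merged into one kernel-verified Lean document; each statement's English description precedes it below -/
import Mathlib

section
/- Let V be a finite-dimensional vector space over a field, W a subspace, and T : W → V a linear map. Define W₀ = V, W₁ = W, and W_{i+1} = {v ∈ W_i : T v ∈ W_i} for i ≥ 1 (here T v makes sense since W_{i+1} ⊆ W₁). Then for each j ≥ 1, dim(W_{j-1}/W_j) ≥ dim(W_j/W_{j+1}); that is, the sequence of defect dimensions λ_j = dim W_{j-1} − dim W_j is weakly decreasing. -/
open Submodule

section Defs
variable {K V : Type*} [Field K] [AddCommGroup V] [Module K V]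

/-- The chain of subspaces `W₀ = V`, `W₁ = W`, `W_{i+1} = {v ∈ W_i : T v ∈ W_i}`. -/
def subChain (W : Submodule K V) (T : ↥W →ₗ[K] V) : ℕ → Submodule K V
  | 0 => ⊤
  | 1 => W
  | (i+2) => subChain W T (i+1) ⊓ Submodule.map W.subtype ((subChain W T (i+1)).comap T)

theorem subChain_le (W : Submodule K V) (T : ↥W →ₗ[K] V) : ∀ k, subChain W T (k+1) ≤ W := by
  intro k
  induction k with
  | zero => simp [subChain]
  | succ k ih =>
      have h : subChain W T (k+2) ≤ subChain W T (k+1) := by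
        rw [subChain]; exact inf_le_left
      exact le_trans h ih

/-- The `j`-th defect dimension `λ_{j+1} = dim W_j − dim W_{j+1}` (0-indexed). -/
noncomputable def defect (W : Submodule K V) (T : ↥W →ₗ[K] V) (j : ℕ) : ℕ :=
  Module.finrank K (subChain W T j) - Module.finrank K (subChain W T (j+1))

/-- `U` is a `T`-invariant subspace of the domain `W`. -/
def TInv (W : Submodule K V) (T : ↥W →ₗ[K] V) (U : Submodule K V) : Prop :=
  U ≤ W ∧ ∀ v : ↥W, (v : V) ∈ U → T v ∈ U

/-- `T` is simple: its only invariant subspace is zero. -/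
def SimpleMap (W : Submodule K V) (T : ↥W →ₗ[K] V) : Prop :=
  ∀ U : Submodule K V, TInv W T U → U = ⊥

/-- Similarity of linear maps defined on subspaces of `V`. -/
def SimilarMap (W W' : Submodule K V) (T : ↥W →ₗ[K] V) (T' : ↥W' →ₗ[K] V) : Prop :=
  ∃ S : V ≃ₗ[K] V, W.map (S : V →ₗ[K] V) = W' ∧
    ∀ (v : ↥W) (hv : S (v : V) ∈ W'), S (T v) = T' ⟨S (v : V), hv⟩

/-- Gaussian binomial coefficient via the `q`-Pascal recurrence. -/
def qBinom (q : ℕ) : ℕ → ℕ → ℕ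
  | _, 0 => 1
  | 0, _+1 => 0
  | n+1, k+1 => qBinom q n k + q ^ (k+1) * qBinom q n (k+1)

/-- Gaussian multinomial coefficient. -/
def qMultinom (q : ℕ) : List ℕ → ℕ
  | [] => 1
  | a :: l => qBinom q (a + l.sum) a * qMultinom q l

/-- `γ_q(m) = ∏_{i=0}^{m−1}(q^m − q^i)`, the order of `GL_m(𝔽_q)`. -/
def gammaq (q m : ℕ) : ℕ := ∏ i ∈ Finset.range m, (q ^ m - q ^ i)

/-- `f` encodes a partition of `n`: `f i` is the `(i+1)`-st part. -/
def IsPartition (n : ℕ) (f : ℕ → ℕ) : Prop :=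
  Antitone f ∧ (∀ i, n ≤ i → f i = 0) ∧ ∑ i ∈ Finset.range n, f i = n

end Defs

theorem aux_rank {K V X : Type*} [Field K] [AddCommGroup V] [Module K V]
    [FiniteDimensional K V] [AddCommGroup X] [Module K X] (A B : Submodule K V) (hBA : B ≤ A)
    (g : ↥A →ₗ[K] X) (h : ∀ a : ↥A, g a = 0 ↔ (a : V) ∈ B) :
    Module.finrank K (LinearMap.range g) + Module.finrank K B = Module.finrank K A := by
  have hk : LinearMap.ker g = B.comap A.subtype := by
    ext a
    simpa using h a
  rw [← LinearMap.finrank_range_add_finrank_ker g, hk,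
    (Submodule.comapSubtypeEquivOfLe hBA).finrank_eq]

theorem aux_le {K V : Type*} [Field K] [AddCommGroup V] [Module K V]
    (W : Submodule K V) (T : ↥W →ₗ[K] V) (j : ℕ) : subChain W T (j+1) ≤ subChain W T j := by
  cases j with
  | zero => simp [subChain]
  | succ j => rw [subChain]; exact inf_le_left

theorem aux_mem {K V : Type*} [Field K] [AddCommGroup V] [Module K V]
    (W : Submodule K V) (T : ↥W →ₗ[K] V) (j : ℕ) (v : ↥W) :
    (v : V) ∈ subChain W T (j+2) ↔ (v : V) ∈ subChain W T (j+1) ∧ T v ∈ subChain W T (j+1) := by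
  rw [subChain]
  simp

/-- the defect dimensions `λ_j = dim W_{j-1} − dim W_j` are weakly decreasing
(here `j ≥ 1` is encoded as `j+1`). -/
theorem defect_antitone {K V : Type*} [Field K] [AddCommGroup V] [Module K V]
    [FiniteDimensional K V] (W : Submodule K V) (T : ↥W →ₗ[K] V) (j : ℕ) :
    Module.finrank K (subChain W T (j+1)) - Module.finrank K (subChain W T (j+2)) ≤
      Module.finrank K (subChain W T j) - Module.finrank K (subChain W T (j+1)) := by
  set A := subChain W T (j+1) with hA
  have h1 := aux_rank A (subChain W T (j+2)) (aux_le W T (j+1))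
    (A.mkQ ∘ₗ T ∘ₗ Submodule.inclusion (subChain_le W T j)) (by
      intro a
      have := aux_mem W T j (Submodule.inclusion (subChain_le W T j) a)
      simp only [Submodule.coe_inclusion] at this
      rw [this]
      simp [← hA])
  have h2 := aux_rank (subChain W T j) A (aux_le W T j)
    (A.mkQ ∘ₗ (subChain W T j).subtype) (by intro a; simp)
  have h3 : LinearMap.range (A.mkQ ∘ₗ T ∘ₗ Submodule.inclusion (subChain_le W T j)) ≤
      LinearMap.range (A.mkQ ∘ₗ (subChain W T j).subtype) := by
    rintro _ ⟨a, rfl⟩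
    have hT : T (Submodule.inclusion (subChain_le W T j) a) ∈ subChain W T j := by
      cases j with
      | zero => simp [subChain]
      | succ j => exact ((aux_mem W T j _).1 a.2).2
    exact ⟨⟨_, hT⟩, rfl⟩
  have h4 := Submodule.finrank_mono h3
  omega
end

section
/- With the chain W₀ = V, W₁ = W, W_{i+1} = {v ∈ W_i : Tv ∈ W_i}, the map φ : W_j/W_{j+1} → W_{j-1}/W_j given by φ(v + W_{j+1}) = Tv + W_j is a well-defined injective linear map for every j ≥ 1. -/
open Submodule

/-- the map `φ : W_j/W_{j+1} → W_{j-1}/W_j`, `φ(v + W_{j+1}) = T v + W_j`,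
is a well-defined injective linear map (here `j ≥ 1` is encoded as `j+1`). -/
theorem exists_injective_quotient_map {K V : Type*} [Field K] [AddCommGroup V] [Module K V]
    [FiniteDimensional K V] (W : Submodule K V) (T : ↥W →ₗ[K] V) (j : ℕ) :
    ∃ φ : (↥(subChain W T (j+1)) ⧸ (subChain W T (j+2)).comap (subChain W T (j+1)).subtype) →ₗ[K]
          (↥(subChain W T j) ⧸ (subChain W T (j+1)).comap (subChain W T j).subtype),
      Function.Injective φ ∧
      ∀ (v : ↥(subChain W T (j+1))) (hvW : (v : V) ∈ W)
        (hTv : T ⟨(v : V), hvW⟩ ∈ subChain W T j),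
        φ (Submodule.Quotient.mk v) =
          Submodule.Quotient.mk (⟨T ⟨(v : V), hvW⟩, hTv⟩ : ↥(subChain W T j)) := by
  have hmem : ∀ (i : ℕ) (v : ↥W), (v : V) ∈ subChain W T (i+2) ↔
      (v : V) ∈ subChain W T (i+1) ∧ T v ∈ subChain W T (i+1) := by
    intro i v
    rw [subChain, Submodule.mem_inf]
    refine and_congr_right fun _ => ?_
    constructor
    · rintro ⟨w, hw, hwv⟩
      have h : w = v := Subtype.ext hwv
      subst h
      exact hw
    · intro h
      exact ⟨v, h, rfl⟩
  have hT : ∀ v : ↥W, (v : V) ∈ subChain W T (j+1) → T v ∈ subChain W T j := by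
    intro v hv
    cases j with
    | zero => simp [subChain]
    | succ i => exact ((hmem i v).1 hv).2
  have hle := subChain_le W T j
  let f : ↥(subChain W T (j+1)) →ₗ[K] ↥(subChain W T j) :=
    (T ∘ₗ Submodule.inclusion hle).codRestrict (subChain W T j)
      (fun v => hT (Submodule.inclusion hle v) v.2)
  have hcomap : (subChain W T (j+2)).comap (subChain W T (j+1)).subtype =
      ((subChain W T (j+1)).comap (subChain W T j).subtype).comap f := by
    ext v
    have h := hmem j (Submodule.inclusion hle v)
    exact ⟨fun hv => (h.1 hv).2, fun hv => h.2 ⟨v.2, hv⟩⟩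
  refine ⟨Submodule.mapQ _ _ f hcomap.le, ?_, ?_⟩
  · rw [injective_iff_map_eq_zero]
    intro x
    induction x using Submodule.Quotient.induction_on with
    | H v =>
      intro hv
      rw [Submodule.mapQ_apply, Submodule.Quotient.mk_eq_zero] at hv
      rw [Submodule.Quotient.mk_eq_zero, hcomap]
      exact hv
  · intro v hvW hTv
    rfl
end

section
/- Let T : W → V and T̃ : W̃ → V be linear maps on subspaces W, W̃ of a finite-dimensional vector space V, and set U = {v ∈ W : Tv ∈ W}, Ũ = {v ∈ W̃ : T̃v ∈ W̃}, with T_U and T̃_Ũ the restrictions of T and T̃. Then T is similar to T̃ (i.e., there is a linear automorphism S of V with S(W) = W̃ and S ∘ T = T̃ ∘ S on W) if and only if T_U is similar to T̃_Ũ and dim W = dim W̃. -/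
open Submodule

theorem exists_equiv_of_ker_eq {K M A B : Type*} [Field K] [AddCommGroup M] [Module K M]
    [AddCommGroup A] [Module K A] [AddCommGroup B] [Module K B]
    [FiniteDimensional K A] [FiniteDimensional K B]
    (hd : Module.finrank K A = Module.finrank K B) (φ : M →ₗ[K] A) (ψ : M →ₗ[K] B)
    (hk : ∀ m, φ m = 0 ↔ ψ m = 0) : ∃ g : A ≃ₗ[K] B, ∀ m, g (φ m) = ψ m := by
  have hker : LinearMap.ker φ = LinearMap.ker ψ := by
    ext m; simpa using hk m
  let e : LinearMap.range φ ≃ₗ[K] LinearMap.range ψ :=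
    φ.quotKerEquivRange.symm ≪≫ₗ Submodule.quotEquivOfEq _ _ hker ≪≫ₗ ψ.quotKerEquivRange
  have he : ∀ m, e ⟨φ m, ⟨m, rfl⟩⟩ = ⟨ψ m, ⟨m, rfl⟩⟩ := by
    intro m
    have : φ.quotKerEquivRange.symm ⟨φ m, ⟨m, rfl⟩⟩ = Submodule.Quotient.mk m := by
      rw [LinearEquiv.symm_apply_eq]
      ext
      simp [LinearMap.quotKerEquivRange_apply_mk]
    simp only [e, LinearEquiv.trans_apply, this, Submodule.quotEquivOfEq_mk]
    ext
    simp [LinearMap.quotKerEquivRange_apply_mk]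
  obtain ⟨Q, hQ⟩ := Submodule.exists_isCompl (LinearMap.range φ)
  obtain ⟨Q', hQ'⟩ := Submodule.exists_isCompl (LinearMap.range ψ)
  have h1 := Submodule.finrank_add_eq_of_isCompl hQ
  have h2 := Submodule.finrank_add_eq_of_isCompl hQ'
  have h3 := e.finrank_eq
  let e' : Q ≃ₗ[K] Q' := LinearEquiv.ofFinrankEq _ _ (by omega)
  refine ⟨(Submodule.prodEquivOfIsCompl _ _ hQ).symm ≪≫ₗ (e.prodCongr e') ≪≫ₗ
    Submodule.prodEquivOfIsCompl _ _ hQ', fun m => ?_⟩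
  have := Submodule.prodEquivOfIsCompl_symm_apply_left _ _ hQ ⟨φ m, ⟨m, rfl⟩⟩
  simp only [LinearEquiv.trans_apply]
  simp only at this
  rw [this]
  simp [he]

theorem mem_restr {K V : Type*} [Field K] [AddCommGroup V] [Module K V]
    (W : Submodule K V) (T : ↥W →ₗ[K] V) (v : V) :
    v ∈ Submodule.map W.subtype (W.comap T) ↔ ∃ h : v ∈ W, T ⟨v, h⟩ ∈ W := by
  constructor
  · rintro ⟨w, hw, rfl⟩
    exact ⟨w.2, hw⟩
  · rintro ⟨h, h'⟩
    exact ⟨⟨v, h⟩, h', rfl⟩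

/-- `T` and `T̃` are similar iff their restrictions to
`U = {v ∈ W : Tv ∈ W}` and `Ũ = {v ∈ W̃ : T̃v ∈ W̃}` are similar and `dim W = dim W̃`. -/
theorem similar_iff_restriction_similar {K V : Type*} [Field K] [AddCommGroup V] [Module K V]
    [FiniteDimensional K V] (W W' : Submodule K V) (T : ↥W →ₗ[K] V) (T' : ↥W' →ₗ[K] V) :
    SimilarMap W W' T T' ↔
      (SimilarMap (Submodule.map W.subtype (W.comap T)) (Submodule.map W'.subtype (W'.comap T'))
          (T.comp (Submodule.inclusion (Submodule.map_subtype_le W (W.comap T))))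
          (T'.comp (Submodule.inclusion (Submodule.map_subtype_le W' (W'.comap T')))) ∧
        Module.finrank K ↥W = Module.finrank K ↥W') := by
  constructor
  · rintro ⟨S, hS, hT⟩
    have hm : ∀ v, S v ∈ W' ↔ v ∈ W := by
      intro v
      rw [← hS]
      constructor
      · rintro ⟨w, hw, h⟩
        rwa [← S.injective h]
      · intro h
        exact ⟨v, h, rfl⟩
    refine ⟨⟨S, ?_, ?_⟩, ?_⟩
    · ext x
      obtain ⟨v, rfl⟩ := S.surjective x
      have : S v ∈ Submodule.map (S : V →ₗ[K] V) (Submodule.map W.subtype (W.comap T)) ↔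
          v ∈ Submodule.map W.subtype (W.comap T) := by
        constructor
        · rintro ⟨w, hw, h⟩
          rwa [← S.injective h]
        · intro h
          exact ⟨v, h, rfl⟩
      rw [this, mem_restr, mem_restr]
      constructor
      · rintro ⟨h, h'⟩
        refine ⟨(hm v).2 h, ?_⟩
        rw [← hT ⟨v, h⟩ ((hm v).2 h)]
        exact (hm _).2 h'
      · rintro ⟨h, h'⟩
        refine ⟨(hm v).1 h, ?_⟩
        rw [← hT ⟨v, (hm v).1 h⟩ h] at h'
        exact (hm _).1 h'
    · intro v hv
      exact hT ⟨v, ((mem_restr W T v).1 v.2).1⟩ ((mem_restr W' T' _).1 hv).1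
    · rw [← hS]
      exact (LinearEquiv.finrank_map_eq S W).symm
  · rintro ⟨⟨S, hS, hT⟩, hd⟩
    have hU : ∀ (u : V) (h : u ∈ W), T ⟨u, h⟩ ∈ W → ∃ h' : S u ∈ W',
        T' ⟨S u, h'⟩ ∈ W' ∧ S (T ⟨u, h⟩) = T' ⟨S u, h'⟩ := by
      intro u h hu
      have hu' := (mem_restr W T u).2 ⟨h, hu⟩
      have hSu : S u ∈ Submodule.map W'.subtype (W'.comap T') := by
        rw [← hS]; exact ⟨u, hu', rfl⟩
      obtain ⟨h1, h2⟩ := (mem_restr W' T' _).1 hSu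
      exact ⟨h1, h2, hT ⟨u, hu'⟩ hSu⟩
    have hU' : ∀ (x : V) (h : x ∈ W'), T' ⟨x, h⟩ ∈ W' → ∃ u, ∃ h : u ∈ W, T ⟨u, h⟩ ∈ W ∧ S u = x := by
      intro x h hx
      have hx' := (mem_restr W' T' x).2 ⟨h, hx⟩
      rw [← hS] at hx'
      obtain ⟨u, hu, rfl⟩ := hx'
      obtain ⟨h1, h2⟩ := (mem_restr W T u).1 hu
      exact ⟨u, h1, h2, rfl⟩
    let P : Submodule K V := W ⊓ W'.comap (S : V →ₗ[K] V)
    obtain ⟨S1, hS1⟩ := exists_equiv_of_ker_eq hd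
      (Submodule.inclusion (inf_le_left : P ≤ W))
      (((S : V →ₗ[K] V).comp P.subtype).codRestrict W' (fun p => p.2.2))
      (by
        intro m
        rw [← Submodule.coe_eq_zero, ← Submodule.coe_eq_zero]
        change (m : V) = 0 ↔ S (m : V) = 0
        exact (LinearEquiv.map_eq_zero_iff S).symm)
    have hS1' : ∀ (w : V) (h : w ∈ W) (h' : S w ∈ W'), S1 ⟨w, h⟩ = ⟨S w, h'⟩ :=
      fun w h h' => hS1 ⟨w, h, h'⟩
    have key : ∀ (b : W) (hb : T b ∈ W), (S1 ⟨T b, hb⟩ : V) = T' (S1 b) := by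
      rintro ⟨b, hbW⟩ hb
      obtain ⟨h1, h2, h3⟩ := hU b hbW hb
      rw [hS1' b hbW h1, hS1' (T ⟨b, hbW⟩) hb (h3 ▸ h2)]
      exact h3
    obtain ⟨S2, hS2⟩ := exists_equiv_of_ker_eq (rfl : Module.finrank K V = Module.finrank K V)
      (LinearMap.coprod W.subtype T)
      (LinearMap.coprod (W'.subtype.comp (S1 : W →ₗ[K] W')) (T'.comp (S1 : W →ₗ[K] W')))
      (by
        rintro ⟨a, b⟩
        have main : ∀ hb : T b ∈ W, ((a : V) + T b = 0 ↔ (S1 a : V) + T' (S1 b) = 0) := by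
          intro hb
          rw [← key b hb, ← Submodule.coe_add, ← map_add, Submodule.coe_eq_zero,
            LinearEquiv.map_eq_zero_iff, ← Submodule.coe_eq_zero, Submodule.coe_add]
        simp only [LinearMap.coprod_apply, LinearMap.comp_apply, Submodule.subtype_apply,
          LinearEquiv.coe_coe]
        constructor
        · intro h
          refine (main ?_).1 h
          rw [eq_neg_of_add_eq_zero_right h]
          exact W.neg_mem a.2
        · intro h
          refine (main ?_).2 h
          have h' : T' (S1 b) ∈ W' := by
            rw [eq_neg_of_add_eq_zero_right h]
            exact W'.neg_mem (S1 a).2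
          obtain ⟨u, hu, hTu, hSu⟩ := hU' (S1 b) (S1 b).2 h'
          have : S1 ⟨u, hu⟩ = S1 b := by
            rw [hS1' u hu (hSu ▸ (S1 b).2)]
            exact Subtype.ext hSu
          rwa [← S1.injective this])
    have hA : ∀ w : W, S2 w = S1 w := by
      intro w
      simpa using hS2 (w, 0)
    have hB : ∀ w : W, S2 (T w) = T' (S1 w) := by
      intro w
      simpa using hS2 (0, w)
    refine ⟨S2, ?_, ?_⟩
    · ext x
      constructor
      · rintro ⟨w, hw, rfl⟩
        have := hA ⟨w, hw⟩
        change S2 w ∈ W'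
        rw [this]
        exact (S1 ⟨w, hw⟩).2
      · intro hx
        refine ⟨S1.symm ⟨x, hx⟩, (S1.symm ⟨x, hx⟩).2, ?_⟩
        change S2 _ = x
        rw [hA, LinearEquiv.apply_symm_apply]
    · intro v hv
      rw [hB]
      congr 1
      exact Subtype.ext (hA v).symm
end

section
/- Two linear transformations T ∈ L(W,V) and T̃ ∈ L(W̃,V) on subspaces of a finite-dimensional vector space V over 𝔽_q are similar if and only if they have the same sequence of defect dimensions λ_T = λ_{T̃} and their restrictions to their maximal invariant subspaces are similar linear operators (equivalently, have the same invariant factors). -/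
open Submodule

section Aux
variable {K V : Type*} [Field K] [AddCommGroup V] [Module K V]

theorem aux_mem_succ (W : Submodule K V) (T : ↥W →ₗ[K] V) (i : ℕ) (v : V) :
    v ∈ subChain W T (i+2) ↔
      v ∈ subChain W T (i+1) ∧ ∃ h : v ∈ W, T ⟨v, h⟩ ∈ subChain W T (i+1) := by
  rw [subChain]
  simp only [Submodule.mem_inf, Submodule.mem_map, Submodule.mem_comap]
  constructor
  · rintro ⟨h1, y, hy, rfl⟩
    exact ⟨h1, y.2, hy⟩
  · rintro ⟨h1, h, hy⟩
    exact ⟨h1, ⟨v, h⟩, hy, rfl⟩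

theorem aux_anti (W : Submodule K V) (T : ↥W →ₗ[K] V) (i : ℕ) :
    subChain W T (i+1) ≤ subChain W T i := by
  cases i with
  | zero => simp [subChain]
  | succ i => intro v hv; exact ((aux_mem_succ W T i v).1 hv).1

theorem aux_T_mem (W : Submodule K V) (T : ↥W →ₗ[K] V) (i : ℕ) (v : W)
    (hv : (v : V) ∈ subChain W T (i+1)) : T v ∈ subChain W T i := by
  cases i with
  | zero => simp [subChain]
  | succ i => exact ((aux_mem_succ W T i v).1 hv).2.2

theorem aux_ext0 {X A B : Type*} [AddCommGroup X] [Module K X] [AddCommGroup A] [Module K A]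
    [AddCommGroup B] [Module K B] [FiniteDimensional K A] [FiniteDimensional K B]
    (hd : Module.finrank K A = Module.finrank K B) (a : X →ₗ[K] A) (b : X →ₗ[K] B)
    (hk : LinearMap.ker a = LinearMap.ker b) : ∃ e : A ≃ₗ[K] B, ∀ x, e (a x) = b x := by
  obtain ⟨C, hC⟩ := Submodule.exists_isCompl (LinearMap.range a)
  obtain ⟨D, hD⟩ := Submodule.exists_isCompl (LinearMap.range b)
  let r : LinearMap.range a ≃ₗ[K] LinearMap.range b :=
    a.quotKerEquivRange.symm ≪≫ₗ Submodule.quotEquivOfEq _ _ hk ≪≫ₗ b.quotKerEquivRange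
  have hr : ∀ x, (r ⟨a x, x, rfl⟩ : B) = b x := by
    intro x
    have : a.quotKerEquivRange.symm ⟨a x, x, rfl⟩ = Submodule.Quotient.mk x := by
      rw [LinearEquiv.symm_apply_eq]; rfl
    simp only [r, LinearEquiv.trans_apply, this]
    rfl
  have h1 := Submodule.finrank_add_eq_of_isCompl hC
  have h2 := Submodule.finrank_add_eq_of_isCompl hD
  have h3 := r.finrank_eq
  have h4 : Module.finrank K C = Module.finrank K D := by omega
  let s : C ≃ₗ[K] D := LinearEquiv.ofFinrankEq C D h4
  refine ⟨(Submodule.prodEquivOfIsCompl _ _ hC).symm ≪≫ₗ (r.prodCongr s) ≪≫ₗ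
    Submodule.prodEquivOfIsCompl _ _ hD, fun x => ?_⟩
  have : (Submodule.prodEquivOfIsCompl _ _ hC).symm (a x) = (⟨a x, x, rfl⟩, 0) := by
    rw [LinearEquiv.symm_apply_eq]; simp
  simp only [LinearEquiv.trans_apply, this]
  simp [hr]

theorem aux_ext [FiniteDimensional K V] {X : Type*} [AddCommGroup X] [Module K X]
    (B B' : Submodule K V) (hd : Module.finrank K B = Module.finrank K B')
    (a b : X →ₗ[K] V) (ha : ∀ x, a x ∈ B) (hb : ∀ x, b x ∈ B')
    (hk : ∀ x, a x = 0 ↔ b x = 0) :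
    ∃ S : V ≃ₗ[K] V, B.map (S : V →ₗ[K] V) = B' ∧ ∀ x, S (a x) = b x := by
  obtain ⟨e, he⟩ := aux_ext0 hd (a.codRestrict B ha) (b.codRestrict B' hb)
    (by ext x; simp [hk])
  obtain ⟨S, hS⟩ := aux_ext0 (K := K) (A := V) (B := V) rfl B.subtype
    (B'.subtype.comp (e : B →ₗ[K] B')) (by
      ext x; simp)
  refine ⟨S, ?_, fun x => ?_⟩
  · ext v
    simp only [Submodule.mem_map]
    constructor
    · rintro ⟨y, hy, rfl⟩
      have := hS ⟨y, hy⟩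
      simp at this
      simp [this]
    · intro hv
      refine ⟨(e.symm ⟨v, hv⟩ : B), (e.symm ⟨v, hv⟩).2, ?_⟩
      have := hS (e.symm ⟨v, hv⟩)
      simpa using this
  · have h1 := hS ⟨a x, ha x⟩
    have h2 := congrArg Subtype.val (he x)
    have h3 : a.codRestrict B ha x = ⟨a x, ha x⟩ := rfl
    rw [h3] at h2
    simp at h1
    rw [h1, h2]; rfl

/-- Stage `i` of the inductive construction. -/
def AuxP (W W' : Submodule K V) (T : ↥W →ₗ[K] V) (T' : ↥W' →ₗ[K] V) (i : ℕ) : Prop :=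
  ∃ S : V ≃ₗ[K] V, (subChain W T i).map (S : V →ₗ[K] V) = subChain W' T' i ∧
    (subChain W T (i+1)).map (S : V →ₗ[K] V) = subChain W' T' (i+1) ∧
    ∀ (v : ↥W) (_ : (v : V) ∈ subChain W T (i+1)) (hv : S (v : V) ∈ W'),
      S (T v) = T' ⟨S (v : V), hv⟩

theorem aux_step [FiniteDimensional K V]
    (W W' : Submodule K V) (T : ↥W →ₗ[K] V) (T' : ↥W' →ₗ[K] V)
    (hd : ∀ i, Module.finrank K (subChain W T i) = Module.finrank K (subChain W' T' i))
    (i : ℕ) (h : AuxP W W' T T' (i+1)) : AuxP W W' T T' i := by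
  obtain ⟨S, h1, h2, h3⟩ := h
  have hS : ∀ y : subChain W T (i+1), S y ∈ subChain W' T' (i+1) := fun y => by
    rw [← h1]; exact ⟨y, y.2, rfl⟩
  have hW := subChain_le W T i
  have hW' := subChain_le W' T' i
  let t : subChain W T (i+1) →ₗ[K] V := T.comp (Submodule.inclusion hW)
  let s : subChain W T (i+1) →ₗ[K] V := (S : V →ₗ[K] V).comp (subChain W T (i+1)).subtype
  let t' : subChain W T (i+1) →ₗ[K] V := T'.comp (s.codRestrict W' fun y => hW' (hS y))
  have key : ∀ x y : subChain W T (i+1), (y : V) ∈ subChain W T (i+2) →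
      s x + t' y = S (x + t y) := by
    intro x y hy
    have := h3 ⟨y, hW y.2⟩ hy (hW' (hS y))
    rw [map_add]
    change _ = _ + S (T ⟨y, hW y.2⟩)
    rw [this]; rfl
  obtain ⟨R, hR1, hR2⟩ := aux_ext (subChain W T i) (subChain W' T' i) (hd i)
    ((subChain W T (i+1)).subtype.coprod t) (s.coprod t')
    (by
      rintro ⟨x, y⟩
      exact add_mem (aux_anti W T i x.2) (aux_T_mem W T i ⟨y, hW y.2⟩ y.2))
    (by
      rintro ⟨x, y⟩
      exact add_mem (aux_anti W' T' i (hS x)) (aux_T_mem W' T' i ⟨S y, hW' (hS y)⟩ (hS y)))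
    (by
      rintro ⟨x, y⟩
      simp only [LinearMap.coprod_apply, Submodule.subtype_apply]
      constructor
      · intro h
        have hy : (y : V) ∈ subChain W T (i+2) := by
          refine (aux_mem_succ W T i y).2 ⟨y.2, hW y.2, ?_⟩
          change t y ∈ _
          rw [eq_neg_of_add_eq_zero_right h]
          exact neg_mem x.2
        rw [key x y hy, h, map_zero]
      · intro h
        have hy : S (y : V) ∈ subChain W' T' (i+2) := by
          refine (aux_mem_succ W' T' i _).2 ⟨hS y, hW' (hS y), ?_⟩
          change t' y ∈ _
          rw [eq_neg_of_add_eq_zero_right h]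
          exact neg_mem (hS x)
        have hy' : (y : V) ∈ subChain W T (i+2) := by
          rw [← h2] at hy
          obtain ⟨z, hz, hzy⟩ := hy
          have : z = y := S.injective hzy
          exact this ▸ hz
        rw [key x y hy'] at h
        exact (map_eq_zero_iff S S.injective).1 h)
  have hRS : ∀ y : V, y ∈ subChain W T (i+1) → R y = S y := by
    intro y hy
    have := hR2 (⟨y, hy⟩, 0)
    simpa [s] using this
  refine ⟨R, hR1, ?_, ?_⟩
  · rw [← h1]
    ext v
    simp only [Submodule.mem_map]
    constructor
    · rintro ⟨y, hy, rfl⟩; exact ⟨y, hy, (hRS y hy).symm⟩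
    · rintro ⟨y, hy, rfl⟩; exact ⟨y, hy, hRS y hy⟩
  · intro v hv hv'
    have := hR2 (0, ⟨v, hv⟩)
    simp only [LinearMap.coprod_apply, map_zero, zero_add] at this
    change R (T v) = T' ⟨S v, _⟩ at this
    rw [this]
    congr 2
    exact (hRS _ hv).symm

theorem aux_map_le (W W' : Submodule K V) (T : ↥W →ₗ[K] V) (T' : ↥W' →ₗ[K] V) (i : ℕ)
    (S : V ≃ₗ[K] V) (h1 : (subChain W T (i+1)).map (S : V →ₗ[K] V) ≤ subChain W' T' (i+1))
    (h3 : ∀ (v : ↥W) (_ : (v : V) ∈ subChain W T (i+1)) (hv : S (v : V) ∈ W'),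
      S (T v) = T' ⟨S (v : V), hv⟩) :
    (subChain W T (i+2)).map (S : V →ₗ[K] V) ≤ subChain W' T' (i+2) := by
  rintro _ ⟨y, hy, rfl⟩
  obtain ⟨hy1, hyW, hT⟩ := (aux_mem_succ W T i y).1 hy
  have hm : S y ∈ subChain W' T' (i+1) := h1 ⟨y, hy1, rfl⟩
  have hm' := subChain_le W' T' i hm
  refine (aux_mem_succ W' T' i _).2 ⟨hm, hm', ?_⟩
  have := h3 ⟨y, hyW⟩ hy1 hm'
  change T' ⟨S y, hm'⟩ ∈ _
  rw [← this]
  exact h1 ⟨_, hT, rfl⟩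

theorem aux_similar_le (W W' : Submodule K V) (T : ↥W →ₗ[K] V) (T' : ↥W' →ₗ[K] V)
    (S : V ≃ₗ[K] V) (h1 : W.map (S : V →ₗ[K] V) = W')
    (h3 : ∀ (v : ↥W) (hv : S (v : V) ∈ W'), S (T v) = T' ⟨S (v : V), hv⟩) (i : ℕ) :
    (subChain W T (i+1)).map (S : V →ₗ[K] V) ≤ subChain W' T' (i+1) := by
  induction i with
  | zero => simp [subChain, h1]
  | succ i ih => exact aux_map_le W W' T T' i S ih fun v _ hv => h3 v hv

theorem aux_similar_map (W W' : Submodule K V) (T : ↥W →ₗ[K] V) (T' : ↥W' →ₗ[K] V)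
    (S : V ≃ₗ[K] V) (h1 : W.map (S : V →ₗ[K] V) = W')
    (h3 : ∀ (v : ↥W) (hv : S (v : V) ∈ W'), S (T v) = T' ⟨S (v : V), hv⟩) (i : ℕ) :
    (subChain W T i).map (S : V →ₗ[K] V) = subChain W' T' i := by
  cases i with
  | zero => simp [subChain]
  | succ i =>
    apply le_antisymm (aux_similar_le W W' T T' S h1 h3 i)
    have hback := aux_similar_le W' W T' T S.symm (by
        subst h1
        ext v; simp) (by
        intro v hv
        have := h3 ⟨S.symm v, hv⟩ (by simp)
        rw [LinearEquiv.symm_apply_eq, this]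
        congr 2; simp) i
    intro v hv
    exact ⟨S.symm v, hback ⟨v, hv, rfl⟩, by simp⟩

end Aux


/-- `T` and `T̃` are similar iff they have the same defect dimensions and their
restrictions to their maximal invariant subspaces (the chain stabilizes by index
`dim V + 1`, so `W_{dim V + 1}` is the maximal invariant subspace) are similar. -/
theorem similar_iff_defect_and_operator_part {K V : Type*} [Field K] [AddCommGroup V]
    [Module K V] [FiniteDimensional K V]
    (W W' : Submodule K V) (T : ↥W →ₗ[K] V) (T' : ↥W' →ₗ[K] V) :
    SimilarMap W W' T T' ↔
      ((∀ j, defect W T j = defect W' T' j) ∧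
        SimilarMap (subChain W T (Module.finrank K V + 1))
          (subChain W' T' (Module.finrank K V + 1))
          (T.comp (Submodule.inclusion (subChain_le W T (Module.finrank K V))))
          (T'.comp (Submodule.inclusion (subChain_le W' T' (Module.finrank K V))))) := by
  constructor
  · rintro ⟨S, h1, h3⟩
    have hm := aux_similar_map W W' T T' S h1 h3
    have hd : ∀ i, Module.finrank K (subChain W T i) = Module.finrank K (subChain W' T' i) := by
      intro i
      rw [← hm i]
      exact (LinearEquiv.finrank_map_eq S (subChain W T i)).symm
    refine ⟨fun j => by simp only [defect, hd], S, hm _, fun v hv => ?_⟩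
    exact h3 ⟨v, subChain_le W T _ v.2⟩ (subChain_le W' T' _ hv)
  · rintro ⟨hdef, S, h1, h3⟩
    have hd : ∀ i, Module.finrank K (subChain W T i) = Module.finrank K (subChain W' T' i) := by
      intro i
      induction i with
      | zero =>
        have h0 : subChain W T 0 = subChain W' T' 0 := by simp only [subChain]
        rw [h0]
      | succ i ih =>
        have a1 := Submodule.finrank_mono (aux_anti W T i)
        have a2 := Submodule.finrank_mono (aux_anti W' T' i)
        have a3 := hdef i
        simp only [defect] at a3
        omega
    have hc : ∀ (v : ↥W) (_ : (v : V) ∈ subChain W T (Module.finrank K V + 1))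
        (hv : S (v : V) ∈ W'), S (T v) = T' ⟨S (v : V), hv⟩ := by
      intro v hv hv'
      exact h3 ⟨v, hv⟩ (by rw [← h1]; exact ⟨v, hv, rfl⟩)
    have base : AuxP W W' T T' (Module.finrank K V + 1) := by
      refine ⟨S, h1, ?_, fun v hv hv' => hc v (aux_anti W T _ hv) hv'⟩
      apply Submodule.eq_of_le_of_finrank_eq (aux_map_le W W' T T' _ S h1.le hc)
      rw [← hd]
      exact LinearEquiv.finrank_map_eq S _
    have all : ∀ n, AuxP W W' T T' n → AuxP W W' T T' 0 := by
      intro n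
      induction n with
      | zero => exact id
      | succ n ih => exact fun h => ih (aux_step W W' T T' hd n h)
    obtain ⟨R, _, r2, r3⟩ := all _ base
    refine ⟨R, by simpa [subChain] using r2, fun v hv => r3 v ?_ hv⟩
    simp [subChain]
end

section
/- Let U ⊆ W be subspaces of an n-dimensional vector space V over 𝔽_q with dim U = d and dim W = k. The number of k-dimensional subspaces W' of V with W ∩ W' = U equals q^{(k−d)²} · [n−k choose k−d]_q, where [· choose ·]_q is the Gaussian binomial coefficient. -/
open Submodule

theorem qBinom_mul_prod (q : ℕ) : ∀ n k : ℕ,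
    (qBinom q n k : ℤ) * ∏ i ∈ Finset.range k, ((q : ℤ) ^ k - (q : ℤ) ^ i) =
      ∏ i ∈ Finset.range k, ((q : ℤ) ^ n - (q : ℤ) ^ i) := by
  have key : ∀ n k : ℕ, ∏ i ∈ Finset.range (k + 1), ((q : ℤ) ^ (n + 1) - (q : ℤ) ^ i) =
      ((q : ℤ) ^ (n + 1) - 1) * (q : ℤ) ^ k *
        ∏ i ∈ Finset.range k, ((q : ℤ) ^ n - (q : ℤ) ^ i) := by
    intro n k
    rw [Finset.prod_range_succ']
    have : ∀ i ∈ Finset.range k, ((q : ℤ) ^ (n + 1) - (q : ℤ) ^ (i + 1)) =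
        (q : ℤ) * ((q : ℤ) ^ n - (q : ℤ) ^ i) := by
      intro i _; ring
    rw [Finset.prod_congr rfl this, Finset.prod_mul_distrib]
    simp
    ring
  intro n
  induction n with
  | zero =>
    intro k
    cases k with
    | zero => simp [qBinom]
    | succ k =>
      rw [Finset.prod_range_succ' (fun i => ((q : ℤ) ^ 0 - (q : ℤ) ^ i))]
      simp [qBinom]
  | succ n ih =>
    intro k
    cases k with
    | zero => simp [qBinom]
    | succ k =>
      have h1 := ih k
      have h2 := ih (k + 1)
      rw [Finset.prod_range_succ (fun i => ((q : ℤ) ^ n - (q : ℤ) ^ i))] at h2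
      rw [key n k]
      have h3 := key k k
      simp only [qBinom]
      push_cast
      rw [add_mul, mul_assoc ((q : ℤ) ^ (k + 1)), h2, h3, ← h1]
      ring

theorem card_li_int {F V : Type*} [Field F] [Fintype F] [AddCommGroup V]
    [Module F V] [FiniteDimensional F V] (m : ℕ) :
    (Nat.card {s : Fin m → V // LinearIndependent F s} : ℤ) =
      ∏ i ∈ Finset.range m,
        ((Fintype.card F : ℤ) ^ Module.finrank F V - (Fintype.card F : ℤ) ^ i) := by
  classical
  have : Finite V := Module.finite_of_finite F
  have := Fintype.ofFinite V
  by_cases hm : m ≤ Module.finrank F V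
  · rw [card_linearIndependent hm, Finset.prod_range, Nat.cast_prod]
    refine Finset.prod_congr rfl fun i _ => ?_
    rw [Nat.cast_sub (Nat.pow_le_pow_right Fintype.card_pos (by omega))]
    push_cast
    rfl
  · push Not at hm
    rw [Finset.prod_eq_zero (Finset.mem_range.2 hm) (sub_self _)]
    have : IsEmpty {s : Fin m → V // LinearIndependent F s} := by
      refine ⟨fun s => ?_⟩
      have := s.2.fintype_card_le_finrank
      simp at this
      omega
    simp

/-- Lifts of independent families in the quotient. -/
noncomputable def liftEquiv {F V : Type*} [Field F] [AddCommGroup V] [Module F V]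
    (W : Submodule F V) (m : ℕ) :
    {s : Fin m → V // LinearIndependent F (W.mkQ ∘ s)} ≃
      {t : Fin m → V ⧸ W // LinearIndependent F t} × (Fin m → W) where
  toFun s := (⟨W.mkQ ∘ s.1, s.2⟩, fun i =>
    ⟨s.1 i - Function.surjInv W.mkQ_surjective (W.mkQ (s.1 i)), by
      have : s.1 i - Function.surjInv W.mkQ_surjective (W.mkQ (s.1 i)) ∈ LinearMap.ker W.mkQ := by
        rw [LinearMap.mem_ker, map_sub, Function.surjInv_eq W.mkQ_surjective, sub_self]
      rwa [ker_mkQ] at this⟩)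
  invFun p := ⟨fun i => Function.surjInv W.mkQ_surjective (p.1.1 i) + p.2 i, by
    have : W.mkQ ∘ (fun i => Function.surjInv W.mkQ_surjective (p.1.1 i) + (p.2 i : V)) =
        p.1.1 := by
      funext i
      have h0 : W.mkQ (p.2 i : V) = 0 := by simp
      simp only [Function.comp, map_add, Function.surjInv_eq, h0, add_zero]
    rw [this]; exact p.1.2⟩
  left_inv s := by
    ext i
    simp
  right_inv p := by
    have h : ∀ i, W.mkQ (Function.surjInv W.mkQ_surjective (p.1.1 i) + (p.2 i : V)) =
        p.1.1 i := by
      intro i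
      have h0 : W.mkQ (p.2 i : V) = 0 := by simp
      simp only [map_add, Function.surjInv_eq, h0, add_zero]
    refine Prod.ext (Subtype.ext (funext h)) (funext fun i => Subtype.ext ?_)
    show _ + _ - Function.surjInv W.mkQ_surjective (W.mkQ _) = _
    rw [h i]
    abel

theorem li_mkQ_iff {F V : Type*} [Field F] [AddCommGroup V] [Module F V]
    (W : Submodule F V) {m : ℕ} (s : Fin m → V) :
    LinearIndependent F (W.mkQ ∘ s) ↔
      LinearIndependent F s ∧ W ⊓ span F (Set.range s) = ⊥ := by
  constructor
  · intro h
    have h1 := LinearIndependent.of_comp _ h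
    refine ⟨h1, ?_⟩
    rw [eq_bot_iff]
    rintro x ⟨hx1, hx2⟩
    obtain ⟨c, rfl⟩ := (Submodule.mem_span_range_iff_exists_fun F).1 hx2
    have h0 : W.mkQ (∑ i, c i • s i) = 0 := by
      rw [← LinearMap.mem_ker, ker_mkQ]; exact hx1
    rw [map_sum] at h0
    simp only [map_smul] at h0
    have hc := Fintype.linearIndependent_iff.1 h c h0
    simp [hc]
  · rintro ⟨h1, h2⟩
    refine h1.map ?_
    rw [ker_mkQ]
    exact (disjoint_iff.2 h2).symm

/-- Independent families grouped by their span. -/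
noncomputable def spanEquiv {F V : Type*} [Field F] [AddCommGroup V] [Module F V]
    [FiniteDimensional F V] (W : Submodule F V) (m : ℕ) :
    (Σ X : {X : Submodule F V // Module.finrank F X = m ∧ W ⊓ X = ⊥},
      {t : Fin m → X.1 // LinearIndependent F t}) ≃
    {s : Fin m → V // LinearIndependent F (W.mkQ ∘ s)} := by
  have hsp : ∀ (X : {X : Submodule F V // Module.finrank F X = m ∧ W ⊓ X = ⊥})
      (t : {t : Fin m → X.1 // LinearIndependent F t}),
      span F (Set.range fun i => (t.1 i : V)) = X.1 := by
    intro X t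
    have hli : LinearIndependent F (fun i => (t.1 i : V)) :=
      t.2.map' X.1.subtype (ker_subtype _)
    refine Submodule.eq_of_le_of_finrank_eq ?_ ?_
    · rw [span_le]; rintro _ ⟨i, rfl⟩; exact (t.1 i).2
    · rw [finrank_span_eq_card hli, X.2.1, Fintype.card_fin]
  refine Equiv.ofBijective (fun p => ⟨fun i => (p.2.1 i : V), ?_⟩) ⟨?_, ?_⟩
  · rw [li_mkQ_iff, hsp]
    exact ⟨p.2.2.map' p.1.1.subtype (ker_subtype _), p.1.2.2⟩
  · rintro ⟨X, t⟩ ⟨Y, u⟩ h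
    have h' : (fun i => (t.1 i : V)) = fun i => (u.1 i : V) := congrArg Subtype.val h
    have hXY : X = Y := by
      apply Subtype.ext
      rw [← hsp X t, ← hsp Y u, h']
    subst hXY
    congr 1
    ext i
    exact congrFun h' i
  · rintro ⟨s, hs⟩
    obtain ⟨h1, h2⟩ := (li_mkQ_iff W s).1 hs
    refine ⟨⟨⟨span F (Set.range s), ?_, h2⟩,
      ⟨fun i => ⟨s i, subset_span ⟨i, rfl⟩⟩, linearIndependent_span h1⟩⟩, rfl⟩
    rw [finrank_span_eq_card h1, Fintype.card_fin]

theorem card_disjoint {F V : Type*} [Field F] [Fintype F] [AddCommGroup V]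
    [Module F V] [FiniteDimensional F V] (W : Submodule F V) (m : ℕ) :
    Nat.card {X : Submodule F V // Module.finrank F X = m ∧ W ⊓ X = ⊥} =
      Fintype.card F ^ (Module.finrank F W * m) *
        qBinom (Fintype.card F) (Module.finrank F (V ⧸ W)) m := by
  classical
  have : Finite V := Module.finite_of_finite F
  have := Fintype.ofFinite {X : Submodule F V // Module.finrank F X = m ∧ W ⊓ X = ⊥}
  have e := Nat.card_congr ((spanEquiv W m).trans (liftEquiv W m))
  rw [Nat.card_sigma, Nat.card_prod, Nat.card_fun] at e
  have e2 := congrArg (Nat.cast : ℕ → ℤ) e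
  push_cast at e2
  simp only [card_li_int] at e2
  rw [Finset.sum_congr rfl (fun X _ => by rw [X.2.1])] at e2
  rw [Finset.sum_const, Finset.card_univ, ← Nat.card_eq_fintype_card, nsmul_eq_mul,
    ← qBinom_mul_prod _ (Module.finrank F (V ⧸ W)), Module.natCard_eq_pow_finrank (K := F) (V := W), Nat.card_fin,
    Nat.card_eq_fintype_card (α := F)] at e2
  have hne : ∏ i ∈ Finset.range m,
      ((Fintype.card F : ℤ) ^ m - (Fintype.card F : ℤ) ^ i) ≠ 0 := by
    refine Finset.prod_ne_zero_iff.2 fun i hi => ?_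
    have h1 : 1 < Fintype.card F := Fintype.one_lt_card
    have h2 := Nat.pow_lt_pow_right h1 (Finset.mem_range.1 hi)
    have h3 : (Fintype.card F : ℤ) ^ i < (Fintype.card F : ℤ) ^ m := by exact_mod_cast h2
    omega
  have e3 := mul_right_cancel₀ hne (e2.trans
    (by push_cast; ring : _ = ((Fintype.card F ^ (Module.finrank F W * m) *
        qBinom (Fintype.card F) (Module.finrank F (V ⧸ W)) m : ℕ) : ℤ) * _))
  exact_mod_cast e3

theorem finrank_comap_mkQ' {F V : Type*} [Field F] [AddCommGroup V]
    [Module F V] [FiniteDimensional F V] (U : Submodule F V) (X : Submodule F (V ⧸ U)) :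
    Module.finrank F (X.comap U.mkQ) = Module.finrank F X + Module.finrank F U := by
  have h := LinearMap.finrank_range_add_finrank_ker (U.mkQ.domRestrict (X.comap U.mkQ))
  rw [LinearMap.range_domRestrict, map_comap_eq_of_surjective U.mkQ_surjective,
    LinearMap.ker_domRestrict, ker_mkQ] at h
  have hU : U ≤ X.comap U.mkQ := U.le_comap_mkQ X
  have h2 := (Submodule.comapSubtypeEquivOfLe hU).finrank_eq
  rw [← h, ← h2]

/-- the number of `k`-dimensional subspaces `W'` of `V` with `W ∩ W' = U`
equals `q^{(k−d)²} · [n−k choose k−d]_q`. -/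
theorem card_subspaces_inter_eq {F V : Type*} [Field F] [Fintype F] [AddCommGroup V]
    [Module F V] [FiniteDimensional F V] (q n k d : ℕ)
    (hq : Fintype.card F = q) (hn : Module.finrank F V = n)
    (U W : Submodule F V) (hUW : U ≤ W)
    (hd : Module.finrank F ↥U = d) (hk : Module.finrank F ↥W = k) :
    Nat.card {W' : Submodule F V // Module.finrank F ↥W' = k ∧ W ⊓ W' = U} =
      q ^ ((k - d) ^ 2) * qBinom q (n - k) (k - d) := by
  subst hq hn hd hk
  have hW : (W.map U.mkQ).comap U.mkQ = W := by
    rw [comap_map_mkQ, sup_eq_right.2 hUW]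
  have hWd := finrank_comap_mkQ' U (W.map U.mkQ)
  rw [hW] at hWd
  have hQ : Module.finrank F ((V ⧸ U) ⧸ W.map U.mkQ) =
      Module.finrank F V - Module.finrank F W := by
    have h1 := finrank_quotient_add_finrank (W.map U.mkQ)
    have h2 := finrank_quotient_add_finrank U
    omega
  have e : {X : Submodule F (V ⧸ U) // Module.finrank F X =
        Module.finrank F W - Module.finrank F U ∧ W.map U.mkQ ⊓ X = ⊥} ≃
      {W' : Submodule F V // Module.finrank F ↥W' = Module.finrank F W ∧ W ⊓ W' = U} := by
    have hinj : Function.Injective (Submodule.comap U.mkQ) :=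
      Submodule.comap_injective_of_surjective U.mkQ_surjective
    have hiff : ∀ X : Submodule F (V ⧸ U), W.map U.mkQ ⊓ X = ⊥ ↔ W ⊓ X.comap U.mkQ = U := by
      intro X
      rw [← hinj.eq_iff, comap_inf, hW, comap_bot, ker_mkQ]
    refine Equiv.ofBijective (fun X => ⟨X.1.comap U.mkQ, ?_, (hiff _).1 X.2.2⟩) ⟨?_, ?_⟩
    · have := finrank_comap_mkQ' U X.1
      have := X.2.1
      omega
    · intro X Y h
      exact Subtype.ext (hinj (congrArg Subtype.val h))
    · rintro ⟨W', h1, h2⟩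
      have hU : U ≤ W' := by rw [← h2]; exact inf_le_right
      have hW' : (W'.map U.mkQ).comap U.mkQ = W' := by
        rw [comap_map_mkQ, sup_eq_right.2 hU]
      refine ⟨⟨W'.map U.mkQ, ?_, ?_⟩, Subtype.ext hW'⟩
      · have := finrank_comap_mkQ' U (W'.map U.mkQ)
        rw [hW'] at this
        omega
      · rw [hiff, hW', h2]
  rw [← Nat.card_congr e, card_disjoint, hQ, sq,
    show Module.finrank F (W.map U.mkQ) = Module.finrank F W - Module.finrank F U by omega]
end

section
/- For positive integers m ≤ n, the identity ∑_{λ ⊢ n, λ₁ = m} q^{∑_i λ_i²} ∏_{i ≥ 1} [λ_i choose λ_{i+1}]_q = q^{m² + n − m} · [n−1 choose m−1]_q holds, where the sum is over all integer partitions λ of n with largest part m. -/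
open Submodule

theorem qB_zero (q n : ℕ) : qBinom q n 0 = 1 := by cases n <;> simp [qBinom]

theorem qB_succ (q n k : ℕ) :
    qBinom q (n+1) (k+1) = qBinom q n k + q ^ (k+1) * qBinom q n (k+1) := by
  rw [qBinom]

theorem qB_lt (q : ℕ) : ∀ n k, n < k → qBinom q n k = 0 := by
  intro n
  induction n with
  | zero => intro k hk; obtain ⟨k, rfl⟩ : ∃ j, k = j + 1 := ⟨k - 1, by omega⟩; simp [qBinom]
  | succ n ih =>
    intro k hk
    obtain ⟨k, rfl⟩ : ∃ j, k = j + 1 := ⟨k - 1, by omega⟩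
    rw [qB_succ, ih _ (by omega), ih _ (by omega)]; simp

theorem qB_self (q n : ℕ) : qBinom q n n = 1 := by
  induction n with
  | zero => simp [qBinom]
  | succ n ih => rw [qB_succ, ih, qB_lt _ _ _ (by omega)]; simp

/-- The other Pascal recurrence. -/
theorem qB_succ_other (q : ℕ) : ∀ n a b, a + b = n →
    qBinom q (n+1) (a+1) = q ^ b * qBinom q n a + qBinom q n (a+1) := by
  intro n
  induction n with
  | zero =>
    intro a b h
    obtain rfl : a = 0 := by omega
    obtain rfl : b = 0 := by omega
    simp [qBinom]
  | succ n ih =>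
    intro a b h
    rcases b with _ | b
    · obtain rfl : a = n + 1 := by omega
      rw [qB_self, qB_self, qB_lt _ _ _ (by omega)]; simp
    · have h2 := ih a b (by omega)
      rcases a with _ | a
      · rw [qB_succ q (n+1) 0, qB_zero]
        have h3 := qB_succ q n 0
        rw [qB_zero] at h2 h3
        obtain rfl : b = n := by omega
        have : 1 + q ^ 1 * qBinom q b 1 = q ^ b * 1 + qBinom q b 1 := by
          simp only [zero_add] at h2 h3; rw [← h2, h3]
        simp only [zero_add] at h2 h3 ⊢
        calc 1 + q ^ 1 * qBinom q (b+1) 1 = q ^ (b+1) + (1 + q ^ 1 * qBinom q b 1) := by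
              rw [h2]; ring
          _ = _ := by rw [h3]; ring
      · have h1 := ih a (b+1) (by omega)
        have e1 := qB_succ q n a
        have e2 := qB_succ q n (a+1)
        rw [qB_succ q (n+1) (a+1)]
        calc _ = (q ^ (b+1) * qBinom q n a + qBinom q n (a+1)) +
              q ^ (a+1+1) * (q ^ b * qBinom q n (a+1) + qBinom q n (a+1+1)) := by
              rw [h1, h2]
          _ = q ^ (b+1) * (qBinom q n a + q ^ (a+1) * qBinom q n (a+1)) +
              (qBinom q n (a+1) + q ^ (a+1+1) * qBinom q n (a+1+1)) := by ring
          _ = _ := by rw [e1, e2]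

theorem qB_symm (q : ℕ) : ∀ n a b, a + b = n → qBinom q n a = qBinom q n b := by
  intro n
  induction n with
  | zero =>
    intro a b h
    obtain rfl : a = 0 := by omega
    obtain rfl : b = 0 := by omega
    rfl
  | succ n ih =>
    intro a b h
    rcases a with _ | a
    · obtain rfl : b = n + 1 := by omega
      rw [qB_zero, qB_self]
    rcases b with _ | b
    · obtain rfl : a = n := by omega
      rw [qB_zero, qB_self]
    rw [qB_succ, qB_succ_other q n b (a+1) (by omega), ih a (b+1) (by omega),
      ih (a+1) b (by omega)]
    ring

theorem qB_vander (q a : ℕ) : ∀ b r,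
    ∑ j ∈ Finset.range (b+1), q ^ (j * (j + r)) * qBinom q a (j + r) * qBinom q b j =
      qBinom q (a + b) (b + r) := by
  intro b
  induction b with
  | zero => intro r; simp [qB_zero]
  | succ b ih =>
    intro r
    rw [Finset.sum_range_succ']
    have key : ∀ j ∈ Finset.range (b+1),
        q ^ ((j+1) * (j + 1 + r)) * qBinom q a (j + 1 + r) * qBinom q (b+1) (j+1) =
        q ^ (b + r + 1) * (q ^ (j * (j + (r+1))) * qBinom q a (j + (r+1)) * qBinom q b j) +
        q ^ ((j+1) * (j + 1 + r)) * qBinom q a (j + 1 + r) * qBinom q b (j+1) := by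
      intro j hj
      have hj := Finset.mem_range.1 hj
      obtain ⟨c, rfl⟩ : ∃ c, b = j + c := ⟨b - j, by omega⟩
      rw [qB_succ_other q (j + c) j c rfl, show j + (r+1) = j + 1 + r by ring]
      ring
    rw [Finset.sum_congr rfl key, Finset.sum_add_distrib, ← Finset.mul_sum, ih (r+1)]
    have h2 := ih r
    have h3 := Finset.sum_range_succ'
      (fun j => q ^ (j * (j + r)) * qBinom q a (j + r) * qBinom q b j) (b+1)
    rw [Finset.sum_range_succ, h2, qB_lt q b (b+1) (by omega)] at h3
    simp only [qB_zero] at h3 ⊢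
    rw [add_assoc, ← h3, show a + (b+1) = (a + b) + 1 by ring, show b + 1 + r = (b + r) + 1 by ring,
      qB_succ]
    ring_nf

theorem qB_vander' (q m b : ℕ) :
    ∑ j ∈ Finset.range m, q ^ (j * (j + 1)) * qBinom q m (j + 1) * qBinom q b j =
      qBinom q (m + b) (b + 1) := by
  rw [← qB_vander q m b 1]
  have h1 : ∑ j ∈ Finset.range m, q ^ (j * (j + 1)) * qBinom q m (j + 1) * qBinom q b j =
      ∑ j ∈ Finset.range (m + b + 1),
        q ^ (j * (j + 1)) * qBinom q m (j + 1) * qBinom q b j := by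
    apply Finset.sum_subset
    · intro x; simp only [Finset.mem_range]; omega
    · intro x _ hx
      rw [qB_lt q m (x+1) (by simp only [Finset.mem_range] at hx; omega)]; simp
  rw [h1]
  symm
  apply Finset.sum_subset
  · intro x; simp only [Finset.mem_range]; omega
  · intro x _ hx
    rw [qB_lt q b x (by simp only [Finset.mem_range] at hx; omega)]; simp

/-- Prepend a value to a sequence. -/
def seqCons (m : ℕ) (g : ℕ → ℕ) : ℕ → ℕ
  | 0 => m
  | i+1 => g i

open Classical in
/-- The finite set of partitions of `n` with largest part `m` and at most `L` parts. -/
noncomputable def partSet : ℕ → ℕ → ℕ → Finset (ℕ → ℕ)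
  | 0, n, m => if n = 0 ∧ m = 0 then {fun _ => 0} else ∅
  | L+1, n, m => if m ≤ n then
      (Finset.range (m+1)).biUnion (fun k => (partSet L (n-m) k).image (seqCons m)) else ∅

theorem mem_partSet (f : ℕ → ℕ) (L n m : ℕ) : f ∈ partSet L n m ↔
    Antitone f ∧ (∀ i, L ≤ i → f i = 0) ∧ ∑ i ∈ Finset.range L, f i = n ∧ f 0 = m := by
  induction L generalizing f n m with
  | zero =>
    rw [partSet]
    constructor
    · intro h
      split_ifs at h with h0
      · rw [Finset.mem_singleton] at h
        subst h
        refine ⟨fun _ _ _ => le_rfl, fun _ _ => rfl, ?_, ?_⟩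
        · simp [h0.1]
        · simp [h0.2]
      · simp at h
    · rintro ⟨_, h1, h2, h3⟩
      have : f = fun _ => 0 := funext fun i => h1 i (Nat.zero_le _)
      subst this
      simp at h2 h3
      simp [← h2, ← h3]
  | succ L ih =>
    rw [partSet]
    constructor
    · intro h
      split_ifs at h with h0
      · simp only [Finset.mem_biUnion, Finset.mem_range, Finset.mem_image] at h
        obtain ⟨k, hk, g, hg, rfl⟩ := h
        rw [ih] at hg
        obtain ⟨g1, g2, g3, g4⟩ := hg
        refine ⟨antitone_nat_of_succ_le ?_, ?_, ?_, rfl⟩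
        · intro i
          rcases i with _ | i
          · simp only [seqCons]; omega
          · exact g1 (Nat.le_succ i)
        · intro i hi
          rcases i with _ | i
          · omega
          · exact g2 i (by omega)
        · rw [Finset.sum_range_succ']
          simp only [seqCons]
          omega
      · simp at h
    · rintro ⟨h1, h2, h3, h4⟩
      rw [Finset.sum_range_succ'] at h3
      rw [if_pos (by omega)]
      simp only [Finset.mem_biUnion, Finset.mem_range, Finset.mem_image]
      refine ⟨f 1, ?_, fun i => f (i+1), ?_, ?_⟩
      · have := h1 (Nat.zero_le 1); omega
      · rw [ih]
        refine ⟨fun a b hab => h1 (by omega), fun i hi => h2 _ (by omega), by omega, rfl⟩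
      · funext i
        rcases i with _ | i
        · exact h4.symm
        · rfl

/-- The weight of a partition. -/
def wt (q L : ℕ) (f : ℕ → ℕ) : ℕ :=
  q ^ (∑ i ∈ Finset.range L, (f i) ^ 2) * ∏ i ∈ Finset.range L, qBinom q (f i) (f (i + 1))

theorem wt_cons (q L m : ℕ) (g : ℕ → ℕ) :
    wt q (L+1) (seqCons m g) = q ^ (m^2) * (qBinom q m (g 0) * wt q L g) := by
  simp only [wt, Finset.sum_range_succ', Finset.prod_range_succ', seqCons]
  ring

theorem seqCons_inj (m : ℕ) : Function.Injective (seqCons m) := by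
  intro f g h
  funext i
  exact congrFun h (i+1)

theorem sum_rec (q L n m : ℕ) (h : m ≤ n) :
    ∑ f ∈ partSet (L+1) n m, wt q (L+1) f =
      q ^ (m^2) * ∑ k ∈ Finset.range (m+1), qBinom q m k * ∑ g ∈ partSet L (n-m) k, wt q L g := by
  classical
  rw [partSet, if_pos h, Finset.sum_biUnion]
  · rw [Finset.mul_sum]
    refine Finset.sum_congr rfl fun k _ => ?_
    rw [Finset.sum_image (fun a _ b _ hab => seqCons_inj m hab), Finset.mul_sum, Finset.mul_sum]
    refine Finset.sum_congr rfl fun g hg => ?_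
    rw [mem_partSet] at hg
    rw [wt_cons, hg.2.2.2]
  · intro k _ l _ hkl
    rw [Function.onFun, Finset.disjoint_left]
    intro f hf hf'
    simp only [Finset.mem_image] at hf hf'
    obtain ⟨g, hg, rfl⟩ := hf
    obtain ⟨g', hg', he⟩ := hf'
    rw [seqCons_inj m he] at hg'
    rw [mem_partSet] at hg hg'
    exact hkl (hg.2.2.2.symm.trans hg'.2.2.2)

theorem sum_zero (q L n : ℕ) :
    ∑ f ∈ partSet L n 0, wt q L f = if n = 0 then 1 else 0 := by
  induction L with
  | zero => by_cases h : n = 0 <;> simp [partSet, h, wt]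
  | succ L ih => rw [sum_rec _ _ _ _ (Nat.zero_le _)]; simp [qB_zero, ih]

theorem sum_empty (q L n m : ℕ) (h : n < m) : ∑ f ∈ partSet L n m, wt q L f = 0 := by
  cases L with
  | zero => rw [partSet, if_neg (by omega)]; simp
  | succ L => rw [partSet, if_neg (by omega)]; simp

theorem sum_main (q : ℕ) : ∀ L n j, n + 1 ≤ L →
    ∑ f ∈ partSet L (n+1) (j+1), wt q L f = q ^ (j * (j+1) + (n+1)) * qBinom q n j := by
  intro L
  induction L with
  | zero => intro n j h; omega
  | succ L ih =>
    intro n j h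
    by_cases hj : n < j
    · rw [sum_empty _ _ _ _ (by omega), qB_lt _ _ _ hj, mul_zero]
    rw [sum_rec _ _ _ _ (by omega), Finset.sum_range_succ', sum_zero, qB_zero]
    obtain ⟨N, rfl⟩ : ∃ N, n = j + N := ⟨n - j, by omega⟩
    rw [show j + N + 1 - (j + 1) = N by omega]
    rcases N with _ | b
    · rw [Finset.sum_eq_zero]
      · simp only [add_zero, qB_self, if_true]; ring
      · intro k _
        rw [sum_empty _ _ _ _ (by omega), mul_zero]
    · have : ∀ k ∈ Finset.range (j+1), qBinom q (j+1) (k+1) *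
          ∑ g ∈ partSet L (b+1) (k+1), wt q L g =
          q ^ (b+1) * (q ^ (k * (k+1)) * qBinom q (j+1) (k+1) * qBinom q b k) := by
        intro k _
        rw [ih b k (by omega)]
        ring
      rw [Finset.sum_congr rfl this, ← Finset.mul_sum, qB_vander',
        if_neg (by omega), qB_symm q (j+1+b) (b+1) j (by omega),
        show j + (b+1) = j + 1 + b by ring]
      ring

/-- Durfee-square identity: for `0 < m ≤ n`,
`∑_{λ ⊢ n, λ₁ = m} q^{∑ λ_i²} ∏_i [λ_i choose λ_{i+1}]_q = q^{m²+n−m} [n−1 choose m−1]_q`. -/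
theorem durfee_square_identity (q m n : ℕ) (hm : 0 < m) (hmn : m ≤ n) :
    (∑ᶠ (f : ℕ → ℕ) (_ : IsPartition n f ∧ f 0 = m),
        q ^ (∑ i ∈ Finset.range n, (f i) ^ 2) *
          ∏ i ∈ Finset.range n, qBinom q (f i) (f (i + 1))) =
      q ^ (m ^ 2 + (n - m)) * qBinom q (n - 1) (m - 1) := by
  have h1 : ∀ f : ℕ → ℕ, (IsPartition n f ∧ f 0 = m) ↔ f ∈ partSet n n m := by
    intro f
    rw [mem_partSet, IsPartition]
    tauto
  simp only [h1]
  rw [finsum_mem_finset_eq_sum]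
  obtain ⟨j, rfl⟩ : ∃ j, m = j + 1 := ⟨m - 1, by omega⟩
  obtain ⟨N, rfl⟩ : ∃ N, n = N + 1 := ⟨n - 1, by omega⟩
  have h := sum_main q (N+1) N j le_rfl
  simp only [wt] at h
  rw [h, show (j+1)^2 + (N + 1 - (j+1)) = j * (j+1) + (N+1) by
    obtain ⟨c, rfl⟩ : ∃ c, N = j + c := ⟨N - j, by omega⟩
    rw [show j + c + 1 - (j+1) = c by omega]
    ring]
  simp
end

section
/- Let W be a subspace of V with dim V = n over 𝔽_q, let T : W → V be linear with maximal T-invariant subspace U, and define T̂ : W/U → V/U by T̂(v + U) = Tv + U. Let 𝒲 = {v ∈ W : Tv ∈ W} and 𝒲̂ = {α ∈ W/U : T̂(α) ∈ W/U}. Then 𝒲̂ = 𝒲/U (under the identification of W/U with a subspace of V/U). -/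
open Submodule

/-- with `U` the maximal `T`-invariant subspace and `T̂ : W/U → V/U` the induced
map, one has `{α ∈ W/U : T̂ α ∈ W/U} = 𝒲/U`, where `𝒲 = {v ∈ W : Tv ∈ W}`. -/
theorem quotient_W2_eq {F V : Type*} [Field F] [AddCommGroup V] [Module F V]
    [FiniteDimensional F V] (W U : Submodule F V) (T : ↥W →ₗ[F] V)
    (hU : TInv W T U) (hUmax : ∀ U' : Submodule F V, TInv W T U' → U' ≤ U)
    (That : ↥(W.map U.mkQ) →ₗ[F] (V ⧸ U))
    (hThat : ∀ (v : ↥W) (h : U.mkQ (v : V) ∈ W.map U.mkQ),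
      That ⟨U.mkQ (v : V), h⟩ = U.mkQ (T v)) :
    Submodule.map (W.map U.mkQ).subtype ((W.map U.mkQ).comap That) =
      (Submodule.map W.subtype (W.comap T)).map U.mkQ := by
  have hmem : ∀ x : V, U.mkQ x ∈ W.map U.mkQ ↔ x ∈ W := by
    intro x
    constructor
    · rintro ⟨w, hw, hwx⟩
      have h1 : w - x ∈ U := (Submodule.Quotient.eq U).1 hwx
      have h2 := W.sub_mem hw (hU.1 h1)
      simpa using h2
    · intro hx
      exact Submodule.mem_map_of_mem hx
  ext a
  constructor
  · rintro ⟨⟨b, hb⟩, hbT, rfl⟩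
    obtain ⟨w, hw, rfl⟩ := hb
    have hbT' : That ⟨U.mkQ w, (hmem w).2 hw⟩ ∈ W.map U.mkQ := hbT
    rw [hThat ⟨w, hw⟩ ((hmem w).2 hw), hmem] at hbT'
    exact ⟨w, ⟨⟨w, hw⟩, hbT', rfl⟩, rfl⟩
  · rintro ⟨_, ⟨⟨w, hw⟩, hwT, rfl⟩, rfl⟩
    refine ⟨⟨U.mkQ w, (hmem w).2 hw⟩, ?_, rfl⟩
    change That ⟨U.mkQ w, (hmem w).2 hw⟩ ∈ W.map U.mkQ
    rw [hThat ⟨w, hw⟩ ((hmem w).2 hw), hmem]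
    exact hwT
end

section
/- Let T : W → V be a linear map on a subspace W of a finite-dimensional vector space V, with maximal T-invariant subspace U. Then the induced map T̂ : W/U → V/U, T̂(v+U) = Tv+U, is simple: its only invariant subspace contained in its domain is the zero subspace. Moreover, the defect dimension sequence of T̂ equals that of T. -/
open Submodule

theorem finrank_comap_mkQ_aux {F V : Type*} [Field F] [AddCommGroup V] [Module F V]
    [FiniteDimensional F V] (U : Submodule F V) (S : Submodule F (V ⧸ U)) :
    Module.finrank F (S.comap U.mkQ) = Module.finrank F S + Module.finrank F U := by
  have hle : U ≤ S.comap U.mkQ := by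
    intro x hx
    have : U.mkQ x = 0 := by simpa using hx
    rw [Submodule.mem_comap, this]
    exact S.zero_mem
  have h := LinearMap.finrank_range_add_finrank_ker (U.mkQ.domRestrict (S.comap U.mkQ))
  have hr : LinearMap.range (U.mkQ.domRestrict (S.comap U.mkQ)) = S := by
    rw [LinearMap.range_domRestrict]
    exact Submodule.map_comap_eq_of_surjective (Submodule.mkQ_surjective U) S
  have hk : LinearMap.ker (U.mkQ.domRestrict (S.comap U.mkQ))
      = U.comap (S.comap U.mkQ).subtype := by
    ext x
    simp
  rw [hr, hk, (Submodule.comapSubtypeEquivOfLe hle).finrank_eq] at h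
  exact h.symm

/-- the induced map `T̂ : W/U → V/U` on the quotient by the maximal invariant
subspace `U` is simple, and its defect dimension sequence equals that of `T`. -/
theorem induced_map_simple_and_defect {F V : Type*} [Field F] [AddCommGroup V] [Module F V]
    [FiniteDimensional F V] (W U : Submodule F V) (T : ↥W →ₗ[F] V)
    (hU : TInv W T U) (hUmax : ∀ U' : Submodule F V, TInv W T U' → U' ≤ U)
    (That : ↥(W.map U.mkQ) →ₗ[F] (V ⧸ U))
    (hThat : ∀ (v : ↥W) (h : U.mkQ (v : V) ∈ W.map U.mkQ),
      That ⟨U.mkQ (v : V), h⟩ = U.mkQ (T v)) :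
    SimpleMap (W.map U.mkQ) That ∧ ∀ j, defect (W.map U.mkQ) That j = defect W T j := by
  have hW : ∀ v : V, U.mkQ v ∈ W.map U.mkQ → v ∈ W := by
    rintro v ⟨w, hw, hwv⟩
    have h1 : w - v ∈ U := (Submodule.Quotient.eq U).1 hwv
    have h2 := W.sub_mem hw (hU.1 h1)
    simpa using h2
  have hT : ∀ (v : V) (hv : v ∈ W) (h : U.mkQ v ∈ W.map U.mkQ),
      That ⟨U.mkQ v, h⟩ = U.mkQ (T ⟨v, hv⟩) := fun v hv h => hThat ⟨v, hv⟩ h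
  constructor
  · intro U' hU'
    have hinv : TInv W T (U'.comap U.mkQ) := by
      refine ⟨fun v hv => hW v (hU'.1 hv), fun v hv => ?_⟩
      have h := hU'.2 ⟨U.mkQ v, hU'.1 hv⟩ hv
      rw [hThat] at h
      exact h
    have hle := hUmax _ hinv
    rw [eq_bot_iff]
    intro x hx
    obtain ⟨v, rfl⟩ := Submodule.mkQ_surjective U x
    have hv : v ∈ U := hle hx
    simpa using hv
  · have key : ∀ j, (subChain (W.map U.mkQ) That j).comap U.mkQ = subChain W T j := by
      intro j
      induction j with
      | zero => simp [subChain]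
      | succ j ih =>
        cases j with
        | zero =>
          ext v
          simp only [subChain, Submodule.mem_comap]
          exact ⟨hW v, fun h => ⟨v, h, rfl⟩⟩
        | succ j =>
          have ih' : ∀ v, U.mkQ v ∈ subChain (W.map U.mkQ) That (j+1) ↔ v ∈ subChain W T (j+1) :=
            fun v => by rw [← ih]; rfl
          ext v
          simp only [subChain, Submodule.mem_comap, Submodule.mem_inf, ih']
          refine and_congr_right fun hv => ?_
          constructor
          · rintro ⟨⟨x, hx⟩, h, rfl : x = U.mkQ v⟩
            have hvW := hW v hx
            refine ⟨⟨v, hvW⟩, ?_, rfl⟩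
            have h' : That ⟨U.mkQ v, hx⟩ ∈ subChain (W.map U.mkQ) That (j+1) := h
            rw [hT v hvW hx] at h'
            exact (ih' _).1 h'
          · rintro ⟨⟨x, hx⟩, h, rfl : x = v⟩
            have hm : U.mkQ x ∈ W.map U.mkQ := Submodule.mem_map_of_mem hx
            refine ⟨⟨U.mkQ x, hm⟩, ?_, rfl⟩
            change That ⟨U.mkQ x, hm⟩ ∈ subChain (W.map U.mkQ) That (j+1)
            rw [hT x hx hm]
            exact (ih' _).2 h
    intro j
    unfold defect
    rw [← key j, ← key (j+1), finrank_comap_mkQ_aux, finrank_comap_mkQ_aux]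
    omega
end

section
/- Let U ⊆ W be subspaces of an n-dimensional 𝔽_q-vector space V with dim U = d, dim W = k. Fix a linear operator T₀ on U and a simple linear transformation T_s : W/U → V/U. The number of linear maps T : W → V whose maximal invariant subspace is U, whose restriction to U equals T₀, and whose induced map on W/U equals T_s, is exactly q^{d(k−d)}. -/
open Submodule

/-- the number of linear maps `T : W → V` with maximal invariant subspace `U`,
operator part `T₀` and simple part `T_s` equals `q^{d(k−d)}`. -/
theorem card_maps_with_given_parts {F V : Type*} [Field F] [Fintype F] [AddCommGroup V]
    [Module F V] [FiniteDimensional F V] (q n d k : ℕ)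
    (hq : Fintype.card F = q) (hn : Module.finrank F V = n)
    (U W : Submodule F V) (hUW : U ≤ W)
    (hd : Module.finrank F ↥U = d) (hk : Module.finrank F ↥W = k)
    (T₀ : ↥U →ₗ[F] ↥U)
    (Ts : ↥(W.map U.mkQ) →ₗ[F] (V ⧸ U)) (hTs : SimpleMap (W.map U.mkQ) Ts) :
    Nat.card {T : ↥W →ₗ[F] V //
        (TInv W T U ∧ ∀ U' : Submodule F V, TInv W T U' → U' ≤ U) ∧
        (∀ (v : ↥U) (hv : (v : V) ∈ W), T ⟨(v : V), hv⟩ = (T₀ v : V)) ∧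
        (∀ (v : ↥W) (h : U.mkQ (v : V) ∈ W.map U.mkQ),
          Ts ⟨U.mkQ (v : V), h⟩ = U.mkQ (T v))} =
      q ^ (d * (k - d)) := by
  classical
  obtain ⟨s, hs⟩ := U.mkQ.exists_rightInverse_of_surjective (Submodule.range_mkQ U)
  obtain ⟨P, hP⟩ := (Submodule.inclusion hUW).exists_leftInverse_of_injective
    (LinearMap.ker_eq_bot.2 (Submodule.inclusion_injective hUW))
  have hs' : ∀ x, U.mkQ (s x) = x := fun x => LinearMap.congr_fun hs x
  have hP' : ∀ u, P (Submodule.inclusion hUW u) = u := fun x => LinearMap.congr_fun hP x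
  let R : ↥W →ₗ[F] ↥(W.map U.mkQ) :=
    (U.mkQ ∘ₗ W.subtype).codRestrict (W.map U.mkQ)
      (fun v => Submodule.mem_map_of_mem v.2)
  let T1 : ↥W →ₗ[F] V := U.subtype ∘ₗ T₀ ∘ₗ P + s ∘ₗ Ts ∘ₗ R
  have hR : ∀ u : ↥U, R (Submodule.inclusion hUW u) = 0 := by
    intro u
    apply Subtype.ext
    change U.mkQ (u : V) = 0
    simp
  have hU0 : ∀ u : ↥U, U.mkQ (u : V) = 0 := by
    intro u
    simp
  have hT1U : ∀ u : ↥U, T1 (Submodule.inclusion hUW u) = (T₀ u : V) := by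
    intro u
    change ((T₀ (P (Submodule.inclusion hUW u)) : ↥U) : V)
      + s (Ts (R (Submodule.inclusion hUW u))) = _
    rw [hP', hR, map_zero, map_zero, add_zero]
  have hT1Q : ∀ v : ↥W, U.mkQ (T1 v) = Ts (R v) := by
    intro v
    change U.mkQ (((T₀ (P v) : ↥U) : V) + s (Ts (R v))) = _
    rw [map_add, hs', hU0, zero_add]
  have key : ∀ T : ↥W →ₗ[F] V,
      (∀ (v : ↥U) (hv : (v : V) ∈ W), T ⟨(v : V), hv⟩ = (T₀ v : V)) →
      (∀ (v : ↥W) (h : U.mkQ (v : V) ∈ W.map U.mkQ),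
          Ts ⟨U.mkQ (v : V), h⟩ = U.mkQ (T v)) →
      (TInv W T U ∧ ∀ U' : Submodule F V, TInv W T U' → U' ≤ U) := by
    intro T h1 h2
    refine ⟨⟨hUW, fun v hv => ?_⟩, fun U' hU' => ?_⟩
    · have := h1 ⟨v, hv⟩ v.2
      change T v = _ at this
      rw [this]
      exact (T₀ _).2
    · have hb := hTs (U'.map U.mkQ) ⟨Submodule.map_mono hU'.1, ?_⟩
      · intro x hx
        have : U.mkQ x ∈ U'.map U.mkQ := Submodule.mem_map_of_mem hx
        rw [hb, Submodule.mem_bot] at this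
        simpa using this
      · rintro ⟨y, hy⟩ ⟨x, hx, rfl⟩
        rw [h2 ⟨x, hU'.1 hx⟩ hy]
        exact Submodule.mem_map_of_mem (hU'.2 ⟨x, hU'.1 hx⟩ hx)
  let A : Submodule F ↥W := LinearMap.range (Submodule.inclusion hUW)
  let φ : ((↥W ⧸ A) →ₗ[F] ↥U) → {T : ↥W →ₗ[F] V //
        (TInv W T U ∧ ∀ U' : Submodule F V, TInv W T U' → U' ≤ U) ∧
        (∀ (v : ↥U) (hv : (v : V) ∈ W), T ⟨(v : V), hv⟩ = (T₀ v : V)) ∧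
        (∀ (v : ↥W) (h : U.mkQ (v : V) ∈ W.map U.mkQ),
          Ts ⟨U.mkQ (v : V), h⟩ = U.mkQ (T v))} := fun f =>
    have h1 : ∀ (v : ↥U) (hv : (v : V) ∈ W),
        (T1 + U.subtype ∘ₗ f ∘ₗ A.mkQ) ⟨(v : V), hv⟩ = (T₀ v : V) := by
      intro v hv
      change T1 (Submodule.inclusion hUW v)
        + ((f (A.mkQ (Submodule.inclusion hUW v)) : ↥U) : V) = _
      have h0 : A.mkQ (Submodule.inclusion hUW v) = 0 :=
        (Submodule.Quotient.mk_eq_zero A).2 ⟨v, rfl⟩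
      rw [hT1U, h0, map_zero, Submodule.coe_zero, add_zero]
    have h2 : ∀ (v : ↥W) (h : U.mkQ (v : V) ∈ W.map U.mkQ),
        Ts ⟨U.mkQ (v : V), h⟩ = U.mkQ ((T1 + U.subtype ∘ₗ f ∘ₗ A.mkQ) v) := by
      intro v hv
      change Ts (R v) = U.mkQ (T1 v + ((f (A.mkQ v) : ↥U) : V))
      rw [map_add, hU0, add_zero, hT1Q]
    ⟨T1 + U.subtype ∘ₗ f ∘ₗ A.mkQ, key _ h1 h2, h1, h2⟩
  have hφ : Function.Bijective φ := by
    constructor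
    · intro f g hfg
      have h := congrArg Subtype.val hfg
      have h' : U.subtype ∘ₗ f ∘ₗ A.mkQ = U.subtype ∘ₗ g ∘ₗ A.mkQ := add_left_cancel h
      apply LinearMap.ext
      intro x
      obtain ⟨w, rfl⟩ := A.mkQ_surjective x
      exact Subtype.ext (LinearMap.congr_fun h' w)
    · rintro ⟨T, h0, h1, h2⟩
      have hD : ∀ v, (T - T1) v ∈ U := by
        intro v
        rw [← Submodule.Quotient.mk_eq_zero]
        change U.mkQ (T v - T1 v) = 0
        rw [map_sub, hT1Q, ← h2 v (Submodule.mem_map_of_mem v.2)]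
        exact sub_self _
      refine ⟨A.liftQ ((T - T1).codRestrict U hD) ?_, ?_⟩
      · rintro _ ⟨u, rfl⟩
        rw [LinearMap.mem_ker]
        apply Subtype.ext
        change T (Submodule.inclusion hUW u) - T1 (Submodule.inclusion hUW u) = 0
        rw [hT1U]
        exact sub_eq_zero.2 (h1 u (hUW u.2))
      · apply Subtype.ext
        apply LinearMap.ext
        intro v
        change T1 v + (T v - T1 v) = T v
        abel
  rw [← Nat.card_congr (Equiv.ofBijective φ hφ), Module.natCard_eq_pow_finrank (K := F),
    Nat.card_eq_fintype_card, hq, Module.finrank_linearMap, hd]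
  have hA : Module.finrank F ↥A = d := by
    rw [← hd]
    exact LinearMap.finrank_range_of_inj (Submodule.inclusion_injective hUW)
  rw [Submodule.finrank_quotient, hA, hk, mul_comm]
end

section
/- Let W be a proper k-dimensional subspace of an n-dimensional vector space V over 𝔽_q. The number of simple linear transformations T : W → V equals ∏_{i=1}^{k} (q^n − q^i). -/
open Submodule

section Aux

theorem card_pair_aux {A B : Type*} [Finite A] [Finite B] (P : A → Prop) (Q : A → B → Prop) (m : ℕ)
    (h : ∀ a, P a → Nat.card {b // Q a b} = m) :
    Nat.card {p : A × B // P p.1 ∧ Q p.1 p.2} = Nat.card {a // P a} * m := by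
  classical
  have := Fintype.ofFinite A
  have e : {p : A × B // P p.1 ∧ Q p.1 p.2} ≃ Σ a : {a // P a}, {b // Q a.1 b} :=
    { toFun := fun p => ⟨⟨p.1.1, p.2.1⟩, ⟨p.1.2, p.2.2⟩⟩
      invFun := fun s => ⟨(s.1.1, s.2.1), s.1.2, s.2.2⟩
      left_inv := fun p => rfl
      right_inv := fun s => rfl }
  rw [Nat.card_congr e, Nat.card_sigma, Finset.sum_congr rfl (fun a _ => h a.1 a.2)]
  simp

variable {F V : Type*} [Field F] [AddCommGroup V] [Module F V]

def SimpleOn (W : Submodule F V) (T : V →ₗ[F] V) : Prop :=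
  ∀ U : Submodule F V, U ≤ W → (∀ x ∈ U, T x ∈ U) → U = ⊥

def BadVec (W : Submodule F V) (T : V →ₗ[F] V) (w v : V) : Prop :=
  ∃ U : Submodule F V, ∃ a ∈ W, w + a ∈ U ∧ v + T a ∈ U ∧ U ≤ W ⊔ span F {w} ∧
    ∀ x ∈ U, x ∈ W → T x ∈ U

theorem mem_sup_span_aux {W : Submodule F V} {w x : V} :
    x ∈ W ⊔ span F {w} ↔ ∃ y ∈ W, ∃ t : F, x = y + t • w := by
  rw [Submodule.mem_sup]
  constructor
  · rintro ⟨y, hy, z, hz, rfl⟩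
    obtain ⟨t, rfl⟩ := Submodule.mem_span_singleton.1 hz
    exact ⟨y, hy, t, rfl⟩
  · rintro ⟨y, hy, t, rfl⟩
    exact ⟨y, hy, t • w, Submodule.mem_span_singleton.2 ⟨t, rfl⟩, rfl⟩

theorem finrank_split_aux [FiniteDimensional F V] {A C W : Submodule F V} (hs : A ⊔ C = W)
    (hd : A ⊓ C = ⊥) : Module.finrank F W = Module.finrank F A + Module.finrank F C := by
  have := Submodule.finrank_sup_add_finrank_inf_eq A C
  rw [hs, hd] at this
  simpa using this

theorem exists_compl_aux {A W : Submodule F V} (h : A ≤ W) :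
    ∃ C : Submodule F V, A ⊔ C = W ∧ A ⊓ C = ⊥ := by
  obtain ⟨D, hD⟩ := Submodule.exists_isCompl A
  refine ⟨D ⊓ W, ?_, ?_⟩
  · rw [← sup_inf_assoc_of_le D h, hD.sup_eq_top, top_inf_eq]
  · rw [← inf_assoc, hD.inf_eq_bot, bot_inf_eq]

theorem finrank_sup_span_aux [FiniteDimensional F V] {W : Submodule F V} {w : V} (hw : w ∉ W) :
    Module.finrank F ↥(W ⊔ span F {w}) = Module.finrank F W + 1 := by
  have hw0 : w ≠ 0 := fun h => hw (h ▸ W.zero_mem)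
  rw [finrank_split_aux (rfl : W ⊔ span F {w} = _), finrank_span_singleton hw0]
  rw [eq_bot_iff]
  rintro x ⟨hx, hx'⟩
  obtain ⟨t, rfl⟩ := Submodule.mem_span_singleton.1 hx'
  by_cases ht : t = 0
  · simp [ht]
  · exact absurd ((W.smul_mem_iff ht).1 hx) hw

theorem bad_iff_aux {W A C : Submodule F V} {T : V →ₗ[F] V} {w : V} (hw : w ∉ W)
    (hA : A = W ⊓ (W ⊔ span F {w}).comap T) (hs : A ⊔ C = W) (v : V) :
    BadVec W T w v ↔ ∃ c ∈ C, BadVec A T (w + c) (v + T c) := by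
  have hAW : A ≤ W := by rw [hA]; exact inf_le_left
  have hCW : C ≤ W := by rw [← hs]; exact le_sup_right
  have hwW : w ∈ W ⊔ span F {w} := mem_sup_span_aux.2 ⟨0, W.zero_mem, 1, by simp⟩
  have hWW : W ≤ W ⊔ span F {w} := le_sup_left
  constructor
  · rintro ⟨U, a, ha, h1, h2, h3, h4⟩
    obtain ⟨b, hb, c, hc, rfl⟩ := Submodule.mem_sup.1 (hs ▸ ha)
    refine ⟨c, hc, U, b, hb, ?_, ?_, ?_, fun x hx hxA => h4 x hx (hAW hxA)⟩
    · convert h1 using 1; abel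
    · convert h2 using 1; rw [map_add]; abel
    · intro x hx
      obtain ⟨y, hy, t, rfl⟩ := mem_sup_span_aux.1 (h3 hx)
      have hz : y - t • (b + c) ∈ U := by
        convert U.sub_mem hx (U.smul_mem t h1) using 1
        module
      have hz2 : y - t • (b + c) ∈ W := W.sub_mem hy (W.smul_mem t ha)
      have hz3 : y - t • (b + c) ∈ A := by
        rw [hA]; exact ⟨hz2, h3 (h4 _ hz hz2)⟩
      exact mem_sup_span_aux.2 ⟨y - t • (b + c) + t • b, A.add_mem hz3 (A.smul_mem t hb), t,
        by module⟩
  · rintro ⟨c, hc, U, b, hb, h1, h2, h3, h4⟩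
    refine ⟨U, b + c, W.add_mem (hAW hb) (hCW hc), ?_, ?_, ?_, ?_⟩
    · convert h1 using 1; abel
    · convert h2 using 1; rw [map_add]; abel
    · intro x hx
      obtain ⟨y, hy, t, rfl⟩ := mem_sup_span_aux.1 (h3 hx)
      exact mem_sup_span_aux.2 ⟨y + t • c, W.add_mem (hAW hy) (W.smul_mem t (hCW hc)), t,
        by module⟩
    · intro x hx hxW
      obtain ⟨y, hy, t, rfl⟩ := mem_sup_span_aux.1 (h3 hx)
      have ht : t = 0 := by
        by_contra ht
        apply hw
        rw [← W.smul_mem_iff ht]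
        convert W.sub_mem hxW (W.add_mem (hAW hy) (W.smul_mem t (hCW hc))) using 1
        module
      apply h4 _ hx
      simpa [ht] using hy

theorem bad_mem_aux {W A C : Submodule F V} {T : V →ₗ[F] V} {w : V}
    (hA : A = W ⊓ (W ⊔ span F {w}).comap T) (hs : A ⊔ C = W) {v c : V} (hc : c ∈ C)
    (h : BadVec A T (w + c) v) : v ∈ W ⊔ span F {w} := by
  have hAW : A ≤ W := by rw [hA]; exact inf_le_left
  have hCW : C ≤ W := by rw [← hs]; exact le_sup_right
  obtain ⟨U, b, hb, h1, h2, h3, h4⟩ := h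
  have hTb : T b ∈ W ⊔ span F {w} := by rw [hA] at hb; exact hb.2
  have : v + T b ∈ W ⊔ span F {w} := by
    obtain ⟨y, hy, t, e⟩ := mem_sup_span_aux.1 (h3 h2)
    exact mem_sup_span_aux.2 ⟨y + t • c, W.add_mem (hAW hy) (W.smul_mem t (hCW hc)), t,
        by rw [e]; module⟩
  simpa using Submodule.sub_mem _ this hTb

theorem card_bad_aux [Fintype F] [FiniteDimensional F V] (T : V →ₗ[F] V) (d : ℕ) :
    ∀ (W : Submodule F V) (w : V), Module.finrank F W = d → w ∉ W →
      Nat.card {v // BadVec W T w v} = Fintype.card F ^ (d + 1) := by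
  have : Finite V := Module.finite_of_finite F
  induction d using Nat.strong_induction_on with
  | _ d ih =>
    intro W w hd hw
    set A := W ⊓ (W ⊔ span F {w}).comap T with hA
    have hAW : A ≤ W := inf_le_left
    by_cases hAe : A = W
    · have : ∀ v, BadVec W T w v ↔ v ∈ W ⊔ span F {w} := by
        intro v
        have hT : ∀ x ∈ W, T x ∈ W ⊔ span F {w} := fun x hx => by
          rw [← hAe] at hx; exact hx.2
        constructor
        · rintro ⟨U, a, ha, h1, h2, h3, h4⟩
          simpa using Submodule.sub_mem _ (h3 h2) (hT a ha)
        · intro hv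
          refine ⟨W ⊔ span F {w}, 0, W.zero_mem, ?_, by simpa using hv, le_rfl,
            fun x _ hx => hT x hx⟩
          exact mem_sup_span_aux.2 ⟨0, W.zero_mem, 1, by simp⟩
      rw [Nat.card_congr (Equiv.subtypeEquivRight this), ← hd, ← finrank_sup_span_aux hw,
        ← Nat.card_eq_fintype_card]
      exact Module.natCard_eq_pow_finrank
    · obtain ⟨C, hs, hdis⟩ := exists_compl_aux hAW
      have hCW : C ≤ W := by rw [← hs]; exact le_sup_right
      have hlt : Module.finrank F A < d := by
        rw [← hd]; exact Submodule.finrank_lt_finrank_of_lt (lt_of_le_of_ne hAW hAe)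
      have hsum := finrank_split_aux hs hdis
      have key := card_pair_aux (A := C) (B := V) (fun _ => True)
        (fun c v => BadVec A T (w + c) v) (Fintype.card F ^ (Module.finrank F A + 1))
        (fun c _ => ih _ hlt A (w + c) rfl (fun h => hw (by
          simpa using W.sub_mem (hAW h) (hCW c.2))))
      have hC : Nat.card {c : C // True} = Fintype.card F ^ Module.finrank F C := by
        rw [Nat.card_congr (Equiv.subtypeUnivEquiv fun _ => trivial),
          ← Nat.card_eq_fintype_card]
        exact Module.natCard_eq_pow_finrank
      rw [hC] at key
      have e : Nat.card {p : C × V // True ∧ BadVec A T (w + p.1) p.2} =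
          Nat.card {v // BadVec W T w v} := by
        refine Nat.card_congr (Equiv.ofBijective (fun p => ⟨p.1.2 - T p.1.1,
          (bad_iff_aux hw hA hs _).2 ⟨p.1.1, p.1.1.2, by simpa using p.2.2⟩⟩) ⟨?_, ?_⟩)
        · rintro ⟨⟨c, v⟩, _, h⟩ ⟨⟨c', v'⟩, _, h'⟩ hpq
          have hvv : v - T c = v' - T c' := congrArg Subtype.val hpq
          have m1 := bad_mem_aux hA hs c.2 h
          have m2 := bad_mem_aux hA hs c'.2 h'
          have hT : T ((c : V) - c') ∈ W ⊔ span F {w} := by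
            have : T ((c : V) - c') = v - v' := by
              rw [map_sub, sub_eq_iff_eq_add.1 hvv]
              abel
            rw [this]; exact Submodule.sub_mem _ m1 m2
          have hz : (c : V) - c' ∈ A ⊓ C :=
            ⟨⟨W.sub_mem (hCW c.2) (hCW c'.2), hT⟩, C.sub_mem c.2 c'.2⟩
          rw [hdis, Submodule.mem_bot, sub_eq_zero] at hz
          have hc : c = c' := Subtype.ext hz
          subst hc
          have : v = v' := by simpa using hvv
          subst this
          rfl
        · rintro ⟨v, hv⟩
          obtain ⟨c, hc, h⟩ := (bad_iff_aux hw hA hs v).1 hv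
          exact ⟨⟨(⟨c, hc⟩, v + T c), trivial, h⟩, Subtype.ext (by simp)⟩
      rw [← e, key, ← pow_add]
      congr 1
      omega

theorem simple_iff_aux {W : Submodule F V} {w : V} (hw : w ∉ W)
    (T : ↥(W ⊔ span F {w}) →ₗ[F] V) (T' : W →ₗ[F] V) (S : V →ₗ[F] V) (v : V)
    (hT : ∀ x (hx : x ∈ W) (hx' : x ∈ W ⊔ span F {w}), T ⟨x, hx'⟩ = T' ⟨x, hx⟩)
    (hv : ∀ hw' : w ∈ W ⊔ span F {w}, T ⟨w, hw'⟩ = v)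
    (hS : ∀ x (hx : x ∈ W), S x = T' ⟨x, hx⟩) :
    SimpleMap (W ⊔ span F {w}) T ↔ SimpleMap W T' ∧ ¬ BadVec W S w v := by
  have hwW : w ∈ W ⊔ span F {w} := mem_sup_span_aux.2 ⟨0, W.zero_mem, 1, by simp⟩
  have hWW : W ≤ W ⊔ span F {w} := le_sup_left
  have hTw : ∀ x (hx : x ∈ W) (t : F) (h : x + t • w ∈ W ⊔ span F {w}),
      T ⟨x + t • w, h⟩ = S x + t • v := by
    intro x hx t h
    rw [hS x hx, ← hT x hx (hWW hx), ← hv hwW, ← map_smul, ← map_add]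
    rfl
  constructor
  · intro h
    refine ⟨fun U hU => h U ⟨hU.1.trans hWW, ?_⟩, ?_⟩
    · rintro ⟨x, hx⟩ hxU
      rw [hT x (hU.1 hxU) hx]
      exact hU.2 ⟨x, hU.1 hxU⟩ hxU
    · rintro ⟨U, a, ha, h1, h2, h3, h4⟩
      have hU : U = ⊥ := by
        refine h U ⟨h3, ?_⟩
        rintro ⟨x, hx⟩ hxU
        obtain ⟨y, hy, t, rfl⟩ := mem_sup_span_aux.1 hx
        rw [hTw y hy]
        have hz : y - t • a ∈ U := by
          convert U.sub_mem hxU (U.smul_mem t h1) using 1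
          module
        have hz2 := h4 _ hz (W.sub_mem hy (W.smul_mem t ha))
        rw [map_sub, map_smul] at hz2
        convert U.add_mem hz2 (U.smul_mem t h2) using 1
        module
      rw [hU, Submodule.mem_bot] at h1
      apply hw
      rw [eq_neg_of_add_eq_zero_left h1]
      exact W.neg_mem ha
  · rintro ⟨h1, h2⟩ U ⟨hU1, hU2⟩
    by_cases hUW : U ≤ W
    · refine h1 U ⟨hUW, ?_⟩
      rintro ⟨x, hx⟩ hxU
      rw [← hT x hx (hWW hx)]
      exact hU2 ⟨x, _⟩ hxU
    · exfalso
      apply h2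
      obtain ⟨x, hxU, hxW⟩ := SetLike.not_le_iff_exists.1 hUW
      obtain ⟨y, hy, t, rfl⟩ := mem_sup_span_aux.1 (hU1 hxU)
      have ht : t ≠ 0 := by
        rintro rfl
        exact hxW (by simpa using hy)
      have hk : w + t⁻¹ • y ∈ U := by
        convert U.smul_mem t⁻¹ hxU using 1
        rw [smul_add, smul_smul, inv_mul_cancel₀ ht, one_smul, add_comm]
      have hk' : t⁻¹ • y + (1 : F) • w ∈ U := by rwa [one_smul, add_comm]
      refine ⟨U, t⁻¹ • y, W.smul_mem _ hy, hk, ?_, hU1, ?_⟩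
      · have := hU2 ⟨_, hU1 hk'⟩ hk'
        rw [hTw _ (W.smul_mem _ hy)] at this
        rwa [one_smul, add_comm] at this
      · intro z hz hzW
        have := hU2 ⟨z, hU1 hz⟩ hz
        rwa [hT z hzW, ← hS z hzW] at this

theorem card_step_aux [Fintype F] [FiniteDimensional F V] {W : Submodule F V} {w : V}
    (hw : w ∉ W) :
    Nat.card {T : ↥(W ⊔ span F {w}) →ₗ[F] V // SimpleMap (W ⊔ span F {w}) T} =
      Nat.card {T : ↥W →ₗ[F] V // SimpleMap W T} *
        (Fintype.card F ^ Module.finrank F V - Fintype.card F ^ (Module.finrank F W + 1)) := by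
  classical
  have : Finite V := Module.finite_of_finite F
  have : Fintype V := Fintype.ofFinite V
  have : Finite (W →ₗ[F] V) := Finite.of_injective (fun f => (f : W → V)) DFunLike.coe_injective
  have hwW : w ∈ W ⊔ span F {w} := mem_sup_span_aux.2 ⟨0, W.zero_mem, 1, by simp⟩
  have hWW : W ≤ W ⊔ span F {w} := le_sup_left
  have hex : ∀ T' : W →ₗ[F] V, ∃ S : V →ₗ[F] V, S.comp W.subtype = T' :=
    fun T' => LinearMap.exists_extend T'
  choose S hS using hex
  have hS' : ∀ (T' : W →ₗ[F] V) x (hx : x ∈ W), S T' x = T' ⟨x, hx⟩ := fun T' x hx => by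
    conv_rhs => rw [← hS T']
    rfl
  rw [← card_pair_aux (fun T' : W →ₗ[F] V => SimpleMap W T')
    (fun T' v => ¬ BadVec W (S T') w v)]
  · refine Nat.card_congr (Equiv.subtypeEquiv (Equiv.ofBijective
      (fun T => (T.comp (Submodule.inclusion hWW), T ⟨w, hwW⟩)) ⟨?_, ?_⟩) ?_)
    · intro T1 T2 h
      obtain ⟨ha, hb⟩ := Prod.ext_iff.1 h
      ext ⟨x, hx⟩
      obtain ⟨y, hy, t, rfl⟩ := mem_sup_span_aux.1 hx
      have e : (⟨y + t • w, hx⟩ : ↥(W ⊔ span F {w})) = ⟨y, hWW hy⟩ + t • ⟨w, hwW⟩ := rfl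
      have ha' : T1 ⟨y, hWW hy⟩ = T2 ⟨y, hWW hy⟩ := LinearMap.congr_fun ha ⟨y, hy⟩
      have hb' : T1 ⟨w, hwW⟩ = T2 ⟨w, hwW⟩ := hb
      rw [e, map_add, map_add, map_smul, map_smul, ha', hb']
    · rintro ⟨T', v⟩
      obtain ⟨f, hf, hfW⟩ := Submodule.exists_le_ker_of_notMem hw
      refine ⟨(S T' + (f.smulRight ((f w)⁻¹ • (v - S T' w)))).comp (Submodule.subtype _), ?_⟩
      refine Prod.ext ?_ ?_
      · ext ⟨y, hy⟩
        have : f y = 0 := hfW hy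
        simp [this, hS' T' y hy]
      · simp [smul_smul, hf]
    · intro T
      exact simple_iff_aux hw T _ _ _ (fun x hx hx' => rfl) (fun _ => rfl) (hS' _)
  · intro T' _
    have hb := card_bad_aux (S T') _ W w rfl hw
    rw [Nat.card_eq_fintype_card] at hb ⊢
    rw [Fintype.card_subtype_compl, hb, ← Nat.card_eq_fintype_card (α := V),
      Module.natCard_eq_pow_finrank (K := F), Nat.card_eq_fintype_card (α := F)]

theorem card_all_aux [Fintype F] [FiniteDimensional F V] (k : ℕ) : ∀ (W : Submodule F V),
    Module.finrank F W = k → Nat.card {T : ↥W →ₗ[F] V // SimpleMap W T} =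
      ∏ i ∈ Finset.Icc 1 k, (Fintype.card F ^ Module.finrank F V - Fintype.card F ^ i) := by
  induction k with
  | zero =>
    intro W hW
    have hW := Submodule.finrank_eq_zero.1 hW
    subst hW
    have : Unique {T : ↥(⊥ : Submodule F V) →ₗ[F] V // SimpleMap ⊥ T} :=
      { default := ⟨0, fun U hU => le_bot_iff.1 hU.1⟩
        uniq := fun T => Subtype.ext (Subsingleton.elim _ _) }
    simp
  | succ k ih =>
    intro W hW
    have hne : W ≠ ⊥ := by
      rintro rfl
      simp at hW
    obtain ⟨w, hwW, hw0⟩ := Submodule.exists_mem_ne_zero_of_ne_bot hne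
    obtain ⟨C, hs, hd⟩ := exists_compl_aux (A := span F {w}) (W := W)
      (by rw [Submodule.span_singleton_le_iff_mem]; exact hwW)
    have hwC : w ∉ C := fun h => hw0 (by
      have : w ∈ span F {w} ⊓ C := ⟨Submodule.mem_span_singleton_self w, h⟩
      rwa [hd, Submodule.mem_bot] at this)
    rw [sup_comm] at hs
    subst hs
    have hk : Module.finrank F C = k := by
      rw [finrank_sup_span_aux hwC] at hW; omega
    rw [card_step_aux hwC, ih C hk, hk, Finset.prod_Icc_succ_top (by omega)]

end Aux


/-- the number of simple linear transformations `T : W → V` on a proper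
`k`-dimensional subspace `W` of an `n`-dimensional space equals `∏_{i=1}^{k}(q^n − q^i)`. -/
theorem card_simple_maps {F V : Type*} [Field F] [Fintype F] [AddCommGroup V]
    [Module F V] [FiniteDimensional F V] (q n k : ℕ)
    (hq : Fintype.card F = q) (hn : Module.finrank F V = n)
    (W : Submodule F V) (hW : W ≠ ⊤) (hk : Module.finrank F ↥W = k) :
    Nat.card {T : ↥W →ₗ[F] V // SimpleMap W T} = ∏ i ∈ Finset.Icc 1 k, (q ^ n - q ^ i) := by
  subst hq hn
  exact card_all_aux k W hk
end

section
/- Let W be a proper subspace of an n-dimensional vector space V over 𝔽_q and let λ ⊢ n be a partition with λ₁ = n − dim W. The number of simple linear transformations T : W → V whose defect dimension sequence equals λ is σ(λ) = q^{∑_{i≥2} λ_i²} · γ_q(n − λ₁) · ∏_{i ≥ 1} [λ_i choose λ_{i+1}]_q, where γ_q(m) = ∏_{i=0}^{m−1}(q^m − q^i). -/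
open Submodule

section Helpers

/-- Number of injective maps from dimension `k` to dimension `m`. -/
def injq (q k m : ℕ) : ℕ := ∏ i ∈ Finset.range k, (q ^ m - q ^ i)

theorem injq_succ_succ (q k m : ℕ) :
    injq q (k+1) (m+1) = (q ^ (m+1) - 1) * q ^ k * injq q k m := by
  unfold injq
  rw [Finset.prod_range_succ']
  have : ∀ i ∈ Finset.range k, (q ^ (m+1) - q ^ (i+1)) = q * (q ^ m - q ^ i) := by
    intro i _
    rw [Nat.mul_sub, pow_succ', pow_succ']
  rw [Finset.prod_congr rfl this, Finset.prod_mul_distrib]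
  simp
  ring

theorem qBinom_mul_gammaq (q : ℕ) (hq : 1 ≤ q) (m : ℕ) : ∀ k, qBinom q m k * gammaq q k = injq q k m := by
  induction m with
  | zero =>
    intro k
    cases k with
    | zero => simp [qBinom, gammaq, injq]
    | succ k => simp [qBinom, injq, Finset.prod_range_succ']
  | succ m ih =>
    intro k
    cases k with
    | zero => simp [qBinom, gammaq, injq]
    | succ k =>
      have hg : gammaq q (k+1) = (q ^ (k+1) - 1) * q ^ k * gammaq q k := injq_succ_succ q k k
      have h1 : injq q (k+1) m = injq q k m * (q ^ m - q ^ k) := by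
        unfold injq; rw [Finset.prod_range_succ]
      rw [injq_succ_succ, qBinom, add_mul, mul_assoc (q ^ (k+1)), ih (k+1), h1, hg]
      have h2 := ih k
      rcases le_or_gt k m with hkm | hkm
      · have e1 : 1 ≤ q ^ (k+1) := Nat.one_le_pow _ _ hq
        have e2 : 1 ≤ q ^ (m+1) := Nat.one_le_pow _ _ hq
        have e3 : q ^ k ≤ q ^ m := Nat.pow_le_pow_right hq hkm
        zify [e1, e2, e3] at h2 ⊢
        linear_combination ((q:ℤ) ^ (k+1) - 1) * q ^ k * h2
      · have h0 : injq q k m = 0 := by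
          unfold injq
          exact Finset.prod_eq_zero (Finset.mem_range.2 hkm) (by simp)
        rw [h0] at h2 ⊢
        have : qBinom q m k * ((q ^ (k+1) - 1) * q ^ k * gammaq q k)
          = (q ^ (k+1) - 1) * q ^ k * (qBinom q m k * gammaq q k) := by ring
        rw [this, h2]; simp

theorem gammaq_add (q a b : ℕ) :
    gammaq q (a + b) = injq q a (a + b) * q ^ (a * b) * gammaq q b := by
  unfold gammaq injq
  rw [Finset.prod_range_add]
  have : ∀ i ∈ Finset.range b, (q ^ (a+b) - q ^ (a+i)) = q ^ a * (q ^ b - q ^ i) := by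
    intro i _
    rw [Nat.mul_sub, pow_add, pow_add]
  rw [Finset.prod_congr rfl this, Finset.prod_mul_distrib]
  simp [pow_mul]
  ring

variable {F V : Type*} [Field F] [AddCommGroup V] [Module F V]

theorem card_li [Fintype F] [FiniteDimensional F V] {k : ℕ} (hk : k ≤ Module.finrank F V) :
    Nat.card { s : Fin k → V // LinearIndependent F s } =
      injq (Fintype.card F) k (Module.finrank F V) := by
  have : Finite V := Module.finite_of_finite F
  rw [card_linearIndependent hk, injq, Finset.prod_range]

theorem card_subspaces [Fintype F] [FiniteDimensional F V] {d : ℕ} (hd : d ≤ Module.finrank F V) :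
    Nat.card {U : Submodule F V // Module.finrank F U = d} * gammaq (Fintype.card F) d =
      injq (Fintype.card F) d (Module.finrank F V) := by
  classical
  have : Finite V := Module.finite_of_finite F
  rw [← card_li hd]
  have : Fintype {U : Submodule F V // Module.finrank F U = d} := Fintype.ofFinite _
  let g : (Σ U : {U : Submodule F V // Module.finrank F U = d},
      {t : Fin d → U.1 // LinearIndependent F t}) → { s : Fin d → V // LinearIndependent F s } :=
    fun x => ⟨fun i => (x.2.1 i : V), x.2.2.map' x.1.1.subtype (Submodule.ker_subtype _)⟩
  have key : ∀ x, Submodule.span F (Set.range (g x).1) = x.1.1 := by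
    intro x
    apply Submodule.eq_of_le_of_finrank_eq
    · rw [Submodule.span_le]
      rintro _ ⟨i, rfl⟩
      exact (x.2.1 i).2
    · rw [finrank_span_eq_card (g x).2, x.1.2]; simp
  have hg : Function.Bijective g := by
    constructor
    · intro x y hxy
      have h1 : x.1 = y.1 := Subtype.ext (by rw [← key x, ← key y, hxy])
      obtain ⟨U, t⟩ := x
      obtain ⟨U', t'⟩ := y
      obtain rfl : U = U' := h1
      congr 1
      apply Subtype.ext
      funext i
      apply Subtype.ext
      exact congrFun (congrArg Subtype.val hxy) i
    · rintro ⟨s, hs⟩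
      refine ⟨⟨⟨Submodule.span F (Set.range s), by rw [finrank_span_eq_card hs]; simp⟩,
        ⟨fun i => ⟨s i, Submodule.subset_span ⟨i, rfl⟩⟩, ?_⟩⟩, rfl⟩
      exact LinearIndependent.of_comp (Submodule.subtype _) hs
  rw [← Nat.card_eq_of_bijective g hg, Nat.card_sigma]
  have hc : ∀ U : {U : Submodule F V // Module.finrank F U = d},
      Nat.card {t : Fin d → U.1 // LinearIndependent F t} = gammaq (Fintype.card F) d := by
    intro U
    rw [card_li U.2.ge, U.2]; rfl
  simp [hc]

theorem card_hom {C D : Type*} [AddCommGroup C] [Module F C] [AddCommGroup D] [Module F D]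
    [Fintype F] [FiniteDimensional F C] [FiniteDimensional F D] :
    Nat.card (C →ₗ[F] D) = Fintype.card F ^ (Module.finrank F C * Module.finrank F D) := by
  have : Finite (C →ₗ[F] D) := Module.finite_of_finite F
  rw [Module.natCard_eq_pow_finrank (K := F), Module.finrank_linearMap, Nat.card_eq_fintype_card]

theorem card_inj {C D : Type*} [AddCommGroup C] [Module F C] [AddCommGroup D] [Module F D]
    [Fintype F] [FiniteDimensional F C] [FiniteDimensional F D]
    (h : Module.finrank F C ≤ Module.finrank F D) :
    Nat.card {B : C →ₗ[F] D // ∀ c, B c = 0 → c = 0} =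
      injq (Fintype.card F) (Module.finrank F C) (Module.finrank F D) := by
  rw [← card_li h]
  let b := Module.finBasis F C
  refine Nat.card_congr (Equiv.subtypeEquiv (b.constr F).symm.toEquiv ?_)
  intro B
  have hB : (b.constr F).symm.toEquiv B = B ∘ b := by
    ext i; simp [Module.Basis.constr]
  rw [hB, ← LinearMap.ker_eq_bot']
  constructor
  · intro hk
    exact b.linearIndependent.map' B hk
  · intro hl
    rw [LinearMap.ker_eq_bot]
    exact LinearMap.injective_of_linearIndependent b.span_eq hl

theorem card_transverse {C : Type*} [AddCommGroup C] [Module F C]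
    [Fintype F] [FiniteDimensional F C] [FiniteDimensional F V] (W : Submodule F V) (a : ℕ)
    (ha : Module.finrank F W + a = Module.finrank F V) (h : Module.finrank F C ≤ a) :
    Nat.card {B : C →ₗ[F] V // ∀ c, B c ∈ W → c = 0} =
      Fintype.card F ^ (Module.finrank F C * Module.finrank F W) *
      injq (Fintype.card F) (Module.finrank F C) a := by
  obtain ⟨D, hD⟩ := W.exists_isCompl
  have hDa : Module.finrank F D = a := by
    have := Submodule.finrank_add_eq_of_isCompl hD
    omega
  subst hDa
  rw [← card_inj h, ← card_hom, ← Nat.card_prod]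
  let e := Submodule.prodEquivOfIsCompl W D hD
  refine Nat.card_congr
    { toFun := fun B => (LinearMap.fst F W D ∘ₗ e.symm.toLinearMap ∘ₗ B.1,
        ⟨LinearMap.snd F W D ∘ₗ e.symm.toLinearMap ∘ₗ B.1, fun c hc => B.2 c
          ((Submodule.prodEquivOfIsCompl_symm_apply_snd_eq_zero W D hD).1 hc)⟩)
      invFun := fun p => ⟨e.toLinearMap ∘ₗ (p.1.prod p.2.1), fun c hc => p.2.2 c (by
          have := (Submodule.prodEquivOfIsCompl_symm_apply_snd_eq_zero W D hD).2 hc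
          simpa [e] using this)⟩
      left_inv := ?_
      right_inv := ?_ }
  · intro B
    apply Subtype.ext
    ext c
    change e (e.symm (B.1 c)) = B.1 c
    simp
  · rintro ⟨p, r, hr⟩
    refine Prod.ext ?_ (Subtype.ext ?_)
    · ext c
      change (((e.symm (e (p c, r c))).1 : W) : V) = p c
      simp
    · ext c
      change (((e.symm (e (p c, r c))).2 : D) : V) = r c
      simp

theorem defect_zero (W : Submodule F V) (T : ↥W →ₗ[F] V) :
    defect W T 0 = Module.finrank F V - Module.finrank F W := by
  have h1 : Module.finrank F (subChain W T 0) = Module.finrank F V := finrank_top F V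
  rw [defect, h1]; rfl

theorem subChain_restrict (W : Submodule F V) (T : ↥W →ₗ[F] V) (U : Submodule F W)
    (T' : ↥U →ₗ[F] W) (hU : W.comap T = U) (hT : ∀ u : U, (T' u : V) = T u) :
    ∀ j, (subChain U T' j).map W.subtype = subChain W T (j+1) := by
  intro j
  induction j with
  | zero => simp [subChain]
  | succ j ih =>
    rw [subChain, ← ih]
    cases j with
    | zero =>
      ext v
      simp [subChain, hU]
    | succ j =>
      rw [subChain]
      ext v
      simp only [Submodule.mem_map, Submodule.mem_inf, Submodule.mem_comap,
        Submodule.subtype_apply]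
      constructor
      · rintro ⟨w, ⟨hw, u, hu, rfl⟩, rfl⟩
        exact ⟨⟨u, hw, rfl⟩, u, ⟨T' u, hu, hT u⟩, rfl⟩
      · rintro ⟨⟨w, hw, rfl⟩, w', ⟨y, hy, hy'⟩, h⟩
        obtain rfl : w' = w := Subtype.ext h
        have hw' : w' ∈ U := by
          rw [← hU, Submodule.mem_comap, ← hy']; exact y.2
        refine ⟨w', ⟨hw, ⟨w', hw'⟩, ?_, rfl⟩, rfl⟩
        have : T' ⟨w', hw'⟩ = y := Subtype.ext (by rw [hT, hy'])
        rw [this]; exact hy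

theorem defect_restrict (W : Submodule F V) (T : ↥W →ₗ[F] V) (U : Submodule F W)
    (T' : ↥U →ₗ[F] W) (hU : W.comap T = U) (hT : ∀ u : U, (T' u : V) = T u) (j : ℕ) :
    defect W T (j+1) = defect U T' j := by
  unfold defect
  rw [← subChain_restrict W T U T' hU hT, ← subChain_restrict W T U T' hU hT,
    Submodule.finrank_map_subtype_eq, Submodule.finrank_map_subtype_eq]

/-- Extensions of a fixed map. -/
theorem card_fiber [Fintype F] [FiniteDimensional F V] (W : Submodule F V) (U : Submodule F W)
    (a k : ℕ) (ha : Module.finrank F W + a = Module.finrank F V)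
    (hk : Module.finrank F U + k = Module.finrank F W) (hka : k ≤ a) (f : ℕ → ℕ) (hf0 : f 0 = a) :
    Nat.card {T : ↥W →ₗ[F] V // W.comap T = U ∧ ∀ j, defect W T j = f j} =
      Nat.card {T' : ↥U →ₗ[F] W // ∀ j, defect U T' j = f (j+1)} *
        (Fintype.card F ^ (k * Module.finrank F W) * injq (Fintype.card F) k a) := by
  obtain ⟨C, hC⟩ := U.exists_isCompl
  have hCk : Module.finrank F C = k := by
    have := Submodule.finrank_add_eq_of_isCompl hC
    omega
  subst hCk
  rw [← card_transverse (C := C) W a ha hka, ← Nat.card_prod]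
  have hmem : ∀ T : ↥W →ₗ[F] V, W.comap T = U → ∀ u : U, (T ∘ₗ U.subtype) u ∈ W := by
    intro T hT u
    have h : (u : W) ∈ W.comap T := hT.ge u.2
    exact h
  refine Nat.card_congr
    { toFun := fun T => (⟨(T.1 ∘ₗ U.subtype).codRestrict W (hmem T.1 T.2.1), ?_⟩,
        ⟨T.1 ∘ₗ C.subtype, ?_⟩)
      invFun := fun p => ⟨LinearMap.ofIsCompl hC (W.subtype ∘ₗ p.1.1) p.2.1, ?_⟩
      left_inv := ?_
      right_inv := ?_ }
  · intro j
    rw [← defect_restrict W T.1 U _ T.2.1 (fun u => rfl) j]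
    exact T.2.2 _
  · intro c hc
    have h1 : (c : W) ∈ U := by rw [← T.2.1]; exact hc
    exact Subtype.ext (Submodule.disjoint_def.1 hC.disjoint _ h1 c.2)
  · have hcomap : W.comap (LinearMap.ofIsCompl hC (W.subtype ∘ₗ p.1.1) p.2.1) = U := by
      ext w
      obtain ⟨⟨u, c⟩, rfl⟩ := (Submodule.prodEquivOfIsCompl U C hC).surjective w
      rw [Submodule.mem_comap, Submodule.coe_prodEquivOfIsCompl', map_add,
        LinearMap.ofIsCompl_apply_left, LinearMap.ofIsCompl_apply_right,
        Submodule.add_mem_iff_right _ (by simp), Submodule.add_mem_iff_right _ u.2]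
      constructor
      · intro h
        have := p.2.2 c h
        simp [this]
      · intro h
        have : c = 0 := Subtype.ext (Submodule.disjoint_def.1 hC.disjoint _ h c.2)
        simp [this]
    refine ⟨hcomap, ?_⟩
    intro j
    cases j with
    | zero =>
      rw [defect_zero]
      omega
    | succ j =>
      rw [defect_restrict W _ U p.1.1 hcomap (fun u => by
        rw [LinearMap.ofIsCompl_apply_left]; rfl) j]
      exact p.1.2 j
  · intro T
    apply Subtype.ext
    exact LinearMap.ofIsCompl_eq' hC rfl rfl
  · rintro ⟨⟨p, hp⟩, ⟨r, hr⟩⟩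
    refine Prod.ext (Subtype.ext ?_) (Subtype.ext ?_)
    · ext u
      change LinearMap.ofIsCompl hC (W.subtype ∘ₗ p) r (u : W) = p u
      rw [LinearMap.ofIsCompl_apply_left]; rfl
    · ext c
      change LinearMap.ofIsCompl hC (W.subtype ∘ₗ p) r (c : W) = r c
      rw [LinearMap.ofIsCompl_apply_right]

end Helpers

theorem card_defect_aux {F : Type*} [Field F] [Fintype F] (k : ℕ) :
    ∀ {V : Type*} [AddCommGroup V] [Module F V] [FiniteDimensional F V]
    (W : Submodule F V) (f : ℕ → ℕ), Antitone f → (∀ i, k ≤ i → f i = 0) →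
    ∑ i ∈ Finset.range k, f i = Module.finrank F V →
    Module.finrank F W + f 0 = Module.finrank F V →
    Nat.card {T : ↥W →ₗ[F] V // ∀ j, defect W T j = f j} =
      (Fintype.card F) ^ (∑ i ∈ Finset.range k, (f (i + 1)) ^ 2) *
        gammaq (Fintype.card F) (Module.finrank F W) *
        ∏ i ∈ Finset.range k, qBinom (Fintype.card F) (f i) (f (i + 1)) := by
  classical
  induction k with
  | zero =>
    intro V _ _ _ W f _ hf0 hs hW
    simp only [Finset.range_zero, Finset.sum_empty] at hs
    have hV : Subsingleton V := Module.finrank_zero_iff.1 hs.symm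
    have hWz : Module.finrank F W = 0 := by omega
    rw [hWz]
    simp only [Finset.range_zero, Finset.sum_empty, Finset.prod_empty, gammaq, pow_zero, mul_one]
    rw [Nat.card_eq_one_iff_unique]
    refine ⟨⟨fun a b => Subtype.ext (Subsingleton.elim _ _)⟩, ⟨⟨0, fun j => ?_⟩⟩⟩
    rw [hf0 j (Nat.zero_le _), defect, Module.finrank_zero_of_subsingleton]
    simp
  | succ k ih =>
    intro V _ _ _ W f hanti hf0 hs hW
    have : Finite V := Module.finite_of_finite F
    have : Finite (W →ₗ[F] V) := Module.finite_of_finite F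
    have : Fintype (Submodule F W) := Fintype.ofFinite _
    rw [Finset.sum_range_succ'] at hs
    have hs' : ∑ i ∈ Finset.range k, f (i+1) = Module.finrank F W := by omega
    have h1m : f 1 ≤ Module.finrank F W := by
      rcases Nat.eq_zero_or_pos k with rfl | hk
      · rw [hf0 1 (by omega)]; omega
      · rw [← hs']
        exact Finset.single_le_sum (f := fun i => f (i+1)) (fun _ _ => Nat.zero_le _)
          (Finset.mem_range.2 hk)
    obtain ⟨d, hd⟩ := Nat.exists_eq_add_of_le' h1m
    have e : {T : ↥W →ₗ[F] V // ∀ j, defect W T j = f j} ≃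
        Σ U : Submodule F W, {T : ↥W →ₗ[F] V // W.comap T = U ∧ ∀ j, defect W T j = f j} :=
      { toFun := fun T => ⟨W.comap T.1, T.1, rfl, T.2⟩
        invFun := fun x => ⟨x.2.1, x.2.2.2⟩
        left_inv := fun T => rfl
        right_inv := by
          rintro ⟨U, T, rfl, hT⟩
          rfl }
    rw [Nat.card_congr e, Nat.card_sigma]
    have hU : ∀ U : Submodule F W,
        Nat.card {T : ↥W →ₗ[F] V // W.comap T = U ∧ ∀ j, defect W T j = f j} =
        if Module.finrank F U = d then
          ((Fintype.card F) ^ (∑ i ∈ Finset.range k, (f (i + 1 + 1)) ^ 2) *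
            gammaq (Fintype.card F) d *
            ∏ i ∈ Finset.range k, qBinom (Fintype.card F) (f (i+1)) (f (i + 1 + 1))) *
          (Fintype.card F ^ (f 1 * Module.finrank F W) * injq (Fintype.card F) (f 1) (f 0))
        else 0 := by
      intro U
      split_ifs with hUd
      · rw [card_fiber W U (f 0) (f 1) hW (by omega) (hanti (Nat.zero_le 1)) f rfl,
          ih U (fun i => f (i+1)) (fun a b h => hanti (by omega)) (fun i hi => hf0 _ (by omega))
            hs' (by simp only [zero_add]; omega), hUd]
      · have : IsEmpty {T : ↥W →ₗ[F] V // W.comap T = U ∧ ∀ j, defect W T j = f j} := by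
          refine ⟨?_⟩
          rintro ⟨T, rfl, hT⟩
          apply hUd
          have h1 := hT 1
          rw [defect_restrict W T (W.comap T)
            ((T ∘ₗ (W.comap T).subtype).codRestrict W (fun u => u.2)) rfl (fun u => rfl) 0] at h1
          rw [defect_zero] at h1
          have := Submodule.finrank_le (W.comap T)
          omega
        exact Nat.card_of_isEmpty
    rw [Finset.sum_congr rfl (fun U _ => hU U), ← Finset.sum_filter, Finset.sum_const, smul_eq_mul,
      ← Fintype.card_subtype, ← Nat.card_eq_fintype_card]
    have hcs := card_subspaces (F := F) (V := W) (d := d) (by omega)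
    have hg := gammaq_add (Fintype.card F) d (f 1)
    rw [← hd] at hg
    have hqb := qBinom_mul_gammaq (Fintype.card F) Fintype.card_pos (f 0) (f 1)
    rw [Finset.sum_range_succ', Finset.prod_range_succ', hg, ← hcs, ← hqb, hd]
    simp only [zero_add]
    ring

/-- the number of simple linear transformations on a fixed proper subspace `W`
with defect dimension sequence `λ` equals
`σ(λ) = q^{∑_{i≥2} λ_i²} · γ_q(n−λ₁) · ∏_{i≥1}[λ_i choose λ_{i+1}]_q`. -/
theorem card_simple_maps_with_defect {F V : Type*} [Field F] [Fintype F] [AddCommGroup V]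
    [Module F V] [FiniteDimensional F V] (q n : ℕ)
    (hq : Fintype.card F = q) (hn : Module.finrank F V = n)
    (W : Submodule F V) (hW : W ≠ ⊤)
    (f : ℕ → ℕ) (hf : IsPartition n f) (hl : f 0 = n - Module.finrank F ↥W) :
    Nat.card {T : ↥W →ₗ[F] V // SimpleMap W T ∧ ∀ j, defect W T j = f j} =
      q ^ (∑ i ∈ Finset.range n, (f (i + 1)) ^ 2) * gammaq q (n - f 0) *
        ∏ i ∈ Finset.range n, qBinom q (f i) (f (i + 1)) := by
  subst hq
  have hle : Module.finrank F W ≤ Module.finrank F V := Submodule.finrank_le W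
  obtain ⟨hanti, hz, hs⟩ := hf
  have hnf : n - f 0 = Module.finrank F W := by omega
  rw [hnf, ← card_defect_aux n W f hanti hz (by omega) (by omega)]
  refine Nat.card_congr (Equiv.subtypeEquivRight fun T => ⟨fun h => h.2, fun h => ⟨?_, h⟩⟩)
  have hmono : ∀ j, subChain W T (j+1) ≤ subChain W T j := by
    intro j
    cases j with
    | zero => simp [subChain]
    | succ j => rw [subChain]; exact inf_le_left
  have hdim : ∀ j, Module.finrank F (subChain W T j) + ∑ i ∈ Finset.range j, f i = n := by
    intro j
    induction j with
    | zero => rw [← hn]; exact finrank_top F V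
    | succ j ih =>
      rw [Finset.sum_range_succ]
      have h1 := h j
      have h2 := Submodule.finrank_mono (hmono j)
      unfold defect at h1
      omega
  have hbot : subChain W T n = ⊥ := by
    have := hdim n
    rw [← Submodule.finrank_eq_zero (R := F)]
    omega
  rintro U ⟨hUW, hU⟩
  have hUle : ∀ j, U ≤ subChain W T (j+1) := by
    intro j
    induction j with
    | zero => simpa [subChain] using hUW
    | succ j ih =>
      rw [subChain]
      refine le_inf ih ?_
      intro v hv
      exact ⟨⟨v, hUW hv⟩, ih (hU ⟨v, hUW hv⟩ hv), rfl⟩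
  rw [eq_bot_iff, ← hbot]
  exact (hUle n).trans (hmono n)
end
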